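/- arXiv:1812.06342 — 12 statements merged into one kernel-verified Lean document; each statement's English description precedes it below -/
import Mathlib

section
/- Let G_{r,c} be a balanced c-partite tournament such that δ(G_{r,c}) ≥ ⌊(c−2)/4⌋·(r + μ(G_{r,c})) + max{δ_V^+, δ_V^−}. Then for every vertex x of G_{r,c}, T^+(x) ≤ (1/(c−1)^(c−1)) · Σ_{k=0}^{⌊(c−2)/4⌋} C(c−1, k) · d^+(x)^k · d^−(x)^(c−1−k) (which is the paper's bound Σ_{k=0}^{⌊(c−2)/4⌋} C(c−1,k) (d^+(x)/d^−(x))^k (d^−(x)/(c−1))^(c−1) written without division). -/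
open Finset

/-- A balanced `c`-partite tournament `G_{r,c}`: the vertex set is `Fin c × Fin r`,
the partite set `V_i` consists of the vertices with first coordinate `i` (so each
partite set has exactly `r` vertices), there are no arcs inside a partite set, and
between any two vertices of distinct partite sets there is exactly one arc. -/
structure MPT (c r : ℕ) where
  adj : Fin c × Fin r → Fin c × Fin r → Prop
  not_adj_same_part : ∀ u v : Fin c × Fin r, u.1 = v.1 → ¬ adj u v
  adj_iff : ∀ u v : Fin c × Fin r, u.1 ≠ v.1 → (adj u v ↔ ¬ adj v u)

/-- A transversal: a set of vertices having exactly one vertex in each partite set. -/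
def IsTransversal {c r : ℕ} (S : Finset (Fin c × Fin r)) : Prop :=
  ∀ i : Fin c, (S.filter (fun v => v.1 = i)).card = 1

/-- A partition in maximal tournaments: a family of pairwise disjoint transversals
covering all the vertices. -/
def IsMTPartition {c r : ℕ} (P : Finset (Finset (Fin c × Fin r))) : Prop :=
  (∀ S ∈ P, IsTransversal S) ∧
  (∀ S ∈ P, ∀ S' ∈ P, S ≠ S' → Disjoint S S') ∧
  (∀ v : Fin c × Fin r, ∃ S ∈ P, v ∈ S)

namespace MPT

variable {c r : ℕ}

/-- Out-degree `d⁺(x)`. -/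
noncomputable def outDeg (T : MPT c r) (x : Fin c × Fin r) : ℕ :=
  Nat.card {y : Fin c × Fin r // T.adj x y}

/-- In-degree `d⁻(x)`. -/
noncomputable def inDeg (T : MPT c r) (x : Fin c × Fin r) : ℕ :=
  Nat.card {y : Fin c × Fin r // T.adj y x}

/-- `d_i⁺(x)`, the number of out-neighbours of `x` in the partite set `V_i`. -/
noncomputable def outDegIn (T : MPT c r) (x : Fin c × Fin r) (i : Fin c) : ℕ :=
  Nat.card {j : Fin r // T.adj x (i, j)}

/-- `d_i⁻(x)`, the number of in-neighbours of `x` in the partite set `V_i`. -/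
noncomputable def inDegIn (T : MPT c r) (x : Fin c × Fin r) (i : Fin c) : ℕ :=
  Nat.card {j : Fin r // T.adj (i, j) x}

/-- Out-degree of `x` inside the subtournament induced by `S`. -/
noncomputable def outDegOn (T : MPT c r) (S : Finset (Fin c × Fin r))
    (x : Fin c × Fin r) : ℕ :=
  Nat.card {y : Fin c × Fin r // y ∈ S ∧ T.adj x y}

/-- In-degree of `x` inside the subtournament induced by `S`. -/
noncomputable def inDegOn (T : MPT c r) (S : Finset (Fin c × Fin r))
    (x : Fin c × Fin r) : ℕ :=
  Nat.card {y : Fin c × Fin r // y ∈ S ∧ T.adj y x}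

/-- `δ(G_{r,c}) = min over vertices x of min {d⁺(x), d⁻(x)}`. -/
noncomputable def minDeg (T : MPT c r) : ℕ :=
  ⨅ x : Fin c × Fin r, min (T.outDeg x) (T.inDeg x)

/-- `Δ(G_{r,c}) = max over vertices x of max {d⁺(x), d⁻(x)}`. -/
noncomputable def maxDeg (T : MPT c r) : ℕ :=
  ⨆ x : Fin c × Fin r, max (T.outDeg x) (T.inDeg x)

/-- `Δ_V⁺ = max {d_i⁺(x) : x a vertex, i a part}`. -/
noncomputable def maxOutV (T : MPT c r) : ℕ :=
  ⨆ x : Fin c × Fin r, ⨆ i : Fin c, T.outDegIn x i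

/-- `δ_V⁺ = min {d_i⁺(x) : x a vertex, i a part}`. -/
noncomputable def minOutV (T : MPT c r) : ℕ :=
  ⨅ x : Fin c × Fin r, ⨅ i : Fin c, T.outDegIn x i

/-- `Δ_V⁻ = max {d_i⁻(x) : x a vertex, i a part}`. -/
noncomputable def maxInV (T : MPT c r) : ℕ :=
  ⨆ x : Fin c × Fin r, ⨆ i : Fin c, T.inDegIn x i

/-- `δ_V⁻ = min {d_i⁻(x) : x a vertex, i a part}`. -/
noncomputable def minInV (T : MPT c r) : ℕ :=
  ⨅ x : Fin c × Fin r, ⨅ i : Fin c, T.inDegIn x i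

/-- The irregularity restricted to the parts,
`μ(G_{r,c}) = max {Δ_V⁺ − δ_V⁺, Δ_V⁻ − δ_V⁻}`. -/
noncomputable def mu (T : MPT c r) : ℕ :=
  max (T.maxOutV - T.minOutV) (T.maxInV - T.minInV)

/-- `T⁺(x)`: the number of transversals containing `x` in which `x` has
out-degree at most `⌊(c−2)/4⌋`. -/
noncomputable def Tplus (T : MPT c r) (x : Fin c × Fin r) : ℕ :=
  Nat.card {S : Finset (Fin c × Fin r) //
    IsTransversal S ∧ x ∈ S ∧ T.outDegOn S x ≤ (c - 2) / 4}

/-- The subtournament induced by `S` is strongly connected: any vertex of `S` can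
reach any other vertex of `S` by a directed path inside `S`. -/
def StrongOn (T : MPT c r) (S : Finset (Fin c × Fin r)) : Prop :=
  ∀ u ∈ S, ∀ v ∈ S,
    Relation.ReflTransGen (fun a b => a ∈ S ∧ b ∈ S ∧ T.adj a b) u v

/-- A strong partition: a partition in maximal tournaments all of whose
tournaments are strongly connected. -/
def HasStrongPartition (T : MPT c r) : Prop :=
  ∃ P : Finset (Finset (Fin c × Fin r)), IsMTPartition P ∧ ∀ S ∈ P, T.StrongOn S

/-- `ω(P)`: the number of vertices `x` with `δ_P(x) ≤ ⌊(c−2)/4⌋`, where `δ_P(x)`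
is the minimum of the out- and in-degree of `x` in the tournament of `P`
containing `x`. -/
noncomputable def omegaP (T : MPT c r) (P : Finset (Finset (Fin c × Fin r))) : ℕ :=
  Nat.card {x : Fin c × Fin r // ∃ S ∈ P, x ∈ S ∧
    min (T.outDegOn S x) (T.inDegOn S x) ≤ (c - 2) / 4}

open scoped Classical in
/-- `ω(G_{r,c}) = Σ_P ω(P)`, summed over all partitions of `G_{r,c}` in maximal
tournaments. -/
noncomputable def omegaG (T : MPT c r) : ℕ :=
  ∑ P ∈ Finset.univ.filter
      (fun P : Finset (Finset (Fin c × Fin r)) => IsMTPartition P),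
    T.omegaP P

end MPT

namespace TPB
open Polynomial

noncomputable def fac (R a : ℝ) : ℝ[X] := C (R - a) + C a * X

noncomputable def L (q : ℕ) (P : ℝ[X]) : ℝ := ∑ k ∈ Finset.range (q+1), P.coeff k

lemma L_add (q) (P Q : ℝ[X]) : L q (P + Q) = L q P + L q Q := by
  simp [L, Finset.sum_add_distrib]

lemma L_C_mul (q) (t : ℝ) (P : ℝ[X]) : L q (C t * P) = t * L q P := by
  simp [L, Finset.mul_sum]

lemma L_one_sub (q) (P : ℝ[X]) : L q ((1 - X) * P) = P.coeff q := by
  induction q with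
  | zero => simp [L, sub_mul]
  | succ q ih =>
    unfold L at *
    rw [Finset.sum_range_succ, ih]
    simp [sub_mul, coeff_X_mul]

lemma fac_zero (R a : ℝ) (P : ℝ[X]) : (fac R a * P).coeff 0 = (R - a) * P.coeff 0 := by
  simp [fac, add_mul, mul_assoc]

lemma fac_succ (R a : ℝ) (P : ℝ[X]) (q : ℕ) :
    (fac R a * P).coeff (q+1) = (R - a) * P.coeff (q+1) + a * P.coeff q := by
  rw [fac, add_mul, coeff_add, coeff_C_mul, mul_assoc, coeff_C_mul, coeff_X_mul]

variable {ι : Type*} [DecidableEq ι]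

noncomputable def pr (R : ℝ) (a : ι → ℝ) (I : Finset ι) : ℝ[X] := ∏ i ∈ I, fac R (a i)

lemma pr_erase (R : ℝ) (a : ι → ℝ) (I : Finset ι) {i} (hi : i ∈ I) :
    pr R a I = fac R (a i) * pr R a (I.erase i) := (Finset.mul_prod_erase I _ hi).symm

lemma pr_nonneg (R : ℝ) (a : ι → ℝ) (I : Finset ι) (h : ∀ i ∈ I, 0 ≤ a i ∧ a i ≤ R) (k : ℕ) :
    0 ≤ (pr R a I).coeff k := by
  induction I using Finset.induction_on generalizing k with
  | empty => simp [pr, coeff_one]; split_ifs <;> norm_num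
  | insert i I hi ih =>
    have h1 := h i (by simp)
    have h2 := ih (fun j hj => h j (by simp [hj]))
    have : pr R a (insert i I) = fac R (a i) * pr R a I := Finset.prod_insert hi
    rw [this]
    cases k with
    | zero => rw [fac_zero]; exact mul_nonneg (by linarith) (h2 0)
    | succ k =>
      rw [fac_succ]
      exact add_nonneg (mul_nonneg (by linarith) (h2 _)) (mul_nonneg h1.1 (h2 _))

lemma pr_deriv (R : ℝ) (a : ι → ℝ) (I : Finset ι) (q : ℕ) :
    ((q:ℝ)+1) * (pr R a I).coeff (q+1) = ∑ i ∈ I, a i * (pr R a (I.erase i)).coeff q := by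
  have h := congrArg (fun P => Polynomial.coeff P q)
    (Polynomial.derivative_prod_finset (s := I) (f := fun i => fac R (a i)))
  simp only [coeff_derivative, finsetSum_coeff] at h
  rw [mul_comm]
  refine h.trans (Finset.sum_congr rfl fun i _ => ?_)
  have : derivative (fac R (a i)) = C (a i) := by simp [fac]
  rw [this, coeff_mul_C, mul_comm]; rfl

lemma mode (R : ℝ) (hR : 0 < R) (a : ι → ℝ) (q : ℕ) : ∀ (I : Finset ι),
    (∀ i ∈ I, 0 ≤ a i ∧ a i ≤ R) → ((q:ℝ)+1) * R ≤ ∑ i ∈ I, a i →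
    (pr R a I).coeff q ≤ (pr R a I).coeff (q+1) := by
  induction q with
  | zero =>
    intro I h hs
    have hd := pr_deriv R a I 0
    have key : ∀ i ∈ I, a i * (pr R a I).coeff 0 ≤ R * (a i * (pr R a (I.erase i)).coeff 0) := by
      intro i hi
      have hn := pr_nonneg R a (I.erase i) (fun j hj => h j (Finset.mem_of_mem_erase hj)) 0
      rw [pr_erase R a I hi, fac_zero]
      have := h i hi
      nlinarith [mul_nonneg (mul_nonneg this.1 this.1) hn]
    have := Finset.sum_le_sum key
    rw [← Finset.mul_sum, ← hd, ← Finset.sum_mul] at this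
    have hn := pr_nonneg R a I h 0
    have h3 := mul_le_mul_of_nonneg_right hs hn
    simp only [Nat.cast_zero, zero_add, one_mul] at *
    exact le_of_mul_le_mul_left (h3.trans this) hR
  | succ q ih =>
    intro I h hs
    have hd := pr_deriv R a I (q+1)
    have key : ∀ i ∈ I, a i * (pr R a I).coeff (q+1) ≤
        R * (a i * (pr R a (I.erase i)).coeff (q+1)) := by
      intro i hi
      have h' := h i hi
      have hh := ih (I.erase i) (fun j hj => h j (Finset.mem_of_mem_erase hj)) (by
        have := Finset.add_sum_erase I a hi
        push_cast at hs
        linarith)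
      rw [pr_erase R a I hi, fac_succ]
      nlinarith [mul_nonneg (mul_nonneg h'.1 h'.1) (sub_nonneg.2 hh)]
    have := Finset.sum_le_sum key
    rw [← Finset.mul_sum, ← hd, ← Finset.sum_mul] at this
    have hn := pr_nonneg R a I h (q+1)
    have h3 := mul_le_mul_of_nonneg_right hs hn
    have h4 := h3.trans this
    have h5 : 0 < ((q+1:ℕ):ℝ) + 1 := by positivity
    rw [mul_comm _ R, mul_assoc] at h4
    exact le_of_mul_le_mul_left (le_of_mul_le_mul_left h4 hR) h5

lemma mode1 (R : ℝ) (hR : 0 < R) (a : ι → ℝ) (I : Finset ι) (hI : 0 < I.card)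
    (h : ∀ i ∈ I, 0 ≤ a i ∧ a i ≤ R) (hs : (I.card:ℝ) * R ≤ ((I.card:ℝ)+1) * ∑ i ∈ I, a i) :
    (pr R a I).coeff 0 ≤ (pr R a I).coeff 1 := by
  have hd := pr_deriv R a I 0
  obtain ⟨m, hm⟩ : ∃ m : ℝ, m = I.card := ⟨_, rfl⟩
  have hm0 : 0 < m := by rw [hm]; exact_mod_cast hI
  rw [← hm] at hs
  have key : ∀ i ∈ I, ((m+1)^2 * a i - R) * (pr R a I).coeff 0 ≤
      R * m^2 * (a i * (pr R a (I.erase i)).coeff 0) := by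
    intro i hi
    have hn := pr_nonneg R a (I.erase i) (fun j hj => h j (Finset.mem_of_mem_erase hj)) 0
    rw [pr_erase R a I hi, fac_zero]
    nlinarith [mul_nonneg (sq_nonneg ((m+1) * a i - R)) hn]
  have := Finset.sum_le_sum key
  rw [← Finset.mul_sum, ← hd, ← Finset.sum_mul, Finset.sum_sub_distrib, ← Finset.mul_sum,
    Finset.sum_const, nsmul_eq_mul, ← hm] at this
  have hn := pr_nonneg R a I h 0
  simp only [Nat.cast_zero, zero_add, one_mul] at *
  have h3 : R * m^2 ≤ (m+1)^2 * ∑ i ∈ I, a i - m * R := by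
    nlinarith [mul_le_mul_of_nonneg_left hs (by linarith : 0 ≤ m+1)]
  have h4 := (mul_le_mul_of_nonneg_right h3 hn).trans this
  exact le_of_mul_le_mul_left h4 (by positivity)

lemma pair (R a b a' b' : ℝ) (hs : a' + b' = a + b) (hp : a * b ≤ a' * b') (Q : ℝ[X]) (q : ℕ)
    (hQ : 0 ≤ ((1 - X) * Q).coeff q) :
    L q (fac R a * (fac R b * Q)) ≤ L q (fac R a' * (fac R b' * Q)) := by
  have : fac R a' * (fac R b' * Q) = fac R a * (fac R b * Q)
      + C (a'*b' - a*b) * ((1-X) * ((1-X) * Q)) := by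
    have : b' = a + b - a' := by linarith
    subst this
    simp only [fac, C_sub, C_add, C_mul]
    ring
  rw [this, L_add, L_C_mul, L_one_sub]
  have := mul_nonneg (sub_nonneg.2 hp) hQ
  linarith

lemma smooth (R M A : ℝ) (hR : 0 < R) (q : ℕ) (I : Finset ι) (hq : q = 1 → 3 ≤ I.card)
    (N : ℕ) : ∀ (a : ι → ℝ), (I.filter (fun i => a i ≠ A)).card ≤ N →
    (∀ i ∈ I, 0 ≤ a i ∧ a i ≤ R ∧ a i ≤ M) → ∑ i ∈ I, a i = I.card * A →
    (q:ℝ) * (R + M) ≤ ∑ i ∈ I, a i →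
    L q (pr R a I) ≤ L q (fac R A ^ I.card) := by
  induction N with
  | zero =>
    intro a hN h hs hsq
    have : ∀ i ∈ I, a i = A := by
      intro i hi
      by_contra hne
      have : i ∈ I.filter (fun i => a i ≠ A) := by simp [hi, hne]
      rw [Finset.card_eq_zero.1 (Nat.le_zero.1 hN)] at this
      simp at this
    rw [pr, Finset.prod_congr rfl (fun i hi => by rw [this i hi]), Finset.prod_const]
  | succ N ih =>
    intro a hN h hs hsq
    by_cases hall : ∀ i ∈ I, a i = A
    · rw [pr, Finset.prod_congr rfl (fun i hi => by rw [hall i hi]), Finset.prod_const]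
    push Not at hall
    obtain ⟨i0, hi0, hne0⟩ := hall
    obtain ⟨i, hi, hmin⟩ := Finset.exists_min_image I a ⟨i0, hi0⟩
    obtain ⟨j, hj, hmax⟩ := Finset.exists_max_image I a ⟨i0, hi0⟩
    have hsA : ∑ i ∈ I, a i = ∑ i ∈ I, A := by rw [hs]; simp
    have hiA : a i < A := by
      by_contra hc
      push Not at hc
      have := (Finset.sum_eq_sum_iff_of_le (f := fun _ => A) (g := a)
        (fun k hk => hc.trans (hmin k hk))).1 hsA.symm i0 hi0
      exact hne0 this.symm
    have hjA : A < a j := by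
      by_contra hc
      push Not at hc
      have := (Finset.sum_eq_sum_iff_of_le (f := a) (g := fun _ => A)
        (fun k hk => (hmax k hk).trans hc)).1 hsA i0 hi0
      exact hne0 this
    have hij : j ≠ i := by rintro rfl; linarith
    have hj' : j ∈ I.erase i := Finset.mem_erase.2 ⟨hij, hj⟩
    set J := (I.erase i).erase j with hJ
    have hJm : ∀ k ∈ J, k ≠ i ∧ k ≠ j ∧ k ∈ I := by
      intro k hk
      simp only [hJ, Finset.mem_erase] at hk
      exact ⟨hk.2.1, hk.1, hk.2.2⟩
    have sumJ : ∀ f : ι → ℝ, ∑ k ∈ I, f k = f i + (f j + ∑ k ∈ J, f k) := by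
      intro f
      rw [← Finset.add_sum_erase I f hi, ← Finset.add_sum_erase _ f hj']
    have prJ : ∀ f : ι → ℝ, pr R f I = fac R (f i) * (fac R (f j) * pr R f J) := by
      intro f
      rw [pr_erase R f I hi, pr_erase R f _ hj']
    set a' : ι → ℝ := fun k => if k = i then A else if k = j then a i + a j - A else a k with ha'
    have hi' : a' i = A := by simp [ha']
    have hjj' : a' j = a i + a j - A := by simp [ha', hij]
    have hk' : ∀ k, k ≠ i → k ≠ j → a' k = a k := by intro k h1 h2; simp [ha', h1, h2]
    have hJe : pr R a' J = pr R a J :=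
      Finset.prod_congr rfl fun k hk => by rw [hk' k (hJm k hk).1 (hJm k hk).2.1]
    have hsum : ∑ k ∈ I, a' k = ∑ k ∈ I, a k := by
      rw [sumJ, sumJ a, hi', hjj', Finset.sum_congr rfl
        (fun k hk => hk' k (hJm k hk).1 (hJm k hk).2.1)]
      ring
    have hih := ih a' (by
      have hlt : (I.filter (fun i => a' i ≠ A)).card < (I.filter (fun i => a i ≠ A)).card := by
        apply Finset.card_lt_card
        rw [Finset.ssubset_iff_of_subset]
        · exact ⟨i, by simp [hi, hiA.ne], by simp [hi']⟩
        · intro k hk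
          simp only [Finset.mem_filter] at hk ⊢
          refine ⟨hk.1, ?_⟩
          by_cases h1 : k = i
          · rw [h1]; exact hiA.ne
          by_cases h2 : k = j
          · rw [h2]; exact hjA.ne'
          rw [← hk' k h1 h2]; exact hk.2
      omega) (by
      intro k hk
      have h3 := h i hi
      have h4 := h j hj
      by_cases h1 : k = i
      · rw [h1, hi']; refine ⟨?_, ?_, ?_⟩ <;> linarith
      by_cases h2 : k = j
      · rw [h2, hjj']; refine ⟨?_, ?_, ?_⟩ <;> linarith
      rw [hk' k h1 h2]; exact h k hk) (hsum.trans hs) (hsq.trans hsum.ge)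
    refine le_trans ?_ hih
    rw [prJ a, prJ a', hJe]
    apply pair
    · rw [hi', hjj']; ring
    · rw [hi', hjj']; nlinarith [mul_pos (sub_pos.2 hiA) (sub_pos.2 hjA)]
    have hJr : ∀ k ∈ J, 0 ≤ a k ∧ a k ≤ R := fun k hk =>
      ⟨(h k (hJm k hk).2.2).1, (h k (hJm k hk).2.2).2.1⟩
    have hs2 := sumJ a
    have h3 := h i hi
    have h4 := h j hj
    have hcard : J.card + 2 = I.card := by
      have h1 := Finset.card_erase_add_one hi
      have h2 := Finset.card_erase_add_one hj'
      rw [← hJ] at h2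
      omega
    match q, hq, hsq with
    | 0, _, _ =>
      have := pr_nonneg R a J hJr 0
      simpa [sub_mul] using this
    | 1, hq, hsq =>
      have hc : 0 < J.card := by have := hq rfl; omega
      have hms : (J.card:ℝ) * a i ≤ ∑ k ∈ J, a k := by
        have := Finset.card_nsmul_le_sum J a (a i) (fun k hk => hmin k (hJm k hk).2.2)
        simpa using this
      have := mode1 R hR a J hc hJr (by
        have h0 : (0:ℝ) ≤ J.card := Nat.cast_nonneg _
        have : R - a i ≤ ∑ k ∈ J, a k := by
          push_cast at hsq; linarith
        nlinarith)
      rw [sub_mul, one_mul, coeff_sub, coeff_X_mul _ 0]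
      linarith
    | q+2, _, hsq =>
      have := mode R hR a (q+1) J hJr (by
        push_cast at hsq ⊢
        have hM : 0 ≤ M := by linarith
        have : 0 ≤ (q:ℝ) * M := by positivity
        nlinarith)
      rw [sub_mul, one_mul, coeff_sub, coeff_X_mul _ (q+1)]
      linarith

lemma L_pow (q n : ℕ) (R A : ℝ) : L q (fac R A ^ n) =
    ∑ k ∈ Finset.range (q+1), (n.choose k : ℝ) * A ^ k * (R - A) ^ (n - k) := by
  unfold L
  refine Finset.sum_congr rfl fun k _ => ?_
  have : fac R A ^ n = ∑ m ∈ Finset.range (n+1),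
      C (A ^ m * (R - A) ^ (n-m) * (n.choose m : ℝ)) * X ^ m := by
    rw [fac, add_comm, add_pow]
    refine Finset.sum_congr rfl fun m _ => ?_
    simp only [mul_pow, C_mul, C_pow, map_natCast]
    ring
  rw [this, finsetSum_coeff]
  simp only [coeff_C_mul_X_pow]
  rw [Finset.sum_ite_eq]
  split_ifs with h
  · ring
  · rw [Nat.choose_eq_zero_of_lt (by simpa using h)]; simp

open scoped Classical in
lemma count {c r : ℕ} (T : MPT c r) (x : Fin c × Fin r) (q : ℕ) :
    (Nat.card {S : Finset (Fin c × Fin r) //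
      IsTransversal S ∧ x ∈ S ∧ T.outDegOn S x ≤ q} : ℝ) ≤
    L q (pr (r:ℝ) (fun i => (T.outDegIn x i : ℝ)) (Finset.univ.erase x.1)) := by
  set t : Fin c → Finset (Fin r) := fun i => if i = x.1 then {x.2} else Finset.univ with ht
  set n : (Fin c → Fin r) → ℕ := fun f => (Finset.univ.filter (fun i => T.adj x (i, f i))).card
    with hn
  have hx0 : ∀ j, ¬ T.adj x (x.1, j) := fun j => T.not_adj_same_part _ _ rfl
  have hpoly : pr (r:ℝ) (fun i => (T.outDegIn x i : ℝ)) (Finset.univ.erase x.1)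
      = ∑ f ∈ Fintype.piFinset t, (X : ℝ[X]) ^ n f := by
    have h1 : ∀ f : Fin c → Fin r, (X : ℝ[X]) ^ n f
        = ∏ i, (if T.adj x (i, f i) then (X : ℝ[X]) else 1) := by
      intro f
      rw [Finset.prod_ite]; simp [hn]
    simp_rw [h1]
    rw [← Finset.prod_univ_sum t (fun i j => if T.adj x (i, j) then (X : ℝ[X]) else 1)]
    rw [← Finset.mul_prod_erase Finset.univ _ (Finset.mem_univ x.1)]
    have h2 : ∑ j ∈ t x.1, (if T.adj x (x.1, j) then (X : ℝ[X]) else 1) = 1 := by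
      simp [ht, hx0]
    rw [h2, one_mul]
    refine Finset.prod_congr rfl fun i hi => ?_
    have hti : t i = Finset.univ := by simp [ht, (Finset.mem_erase.1 hi).1]
    have h3 : T.outDegIn x i = (Finset.univ.filter (fun j => T.adj x (i, j))).card := by
      rw [MPT.outDegIn, Nat.card_eq_fintype_card, Fintype.card_subtype]
    have h4 := Finset.card_filter_add_card_filter_not (s := (Finset.univ : Finset (Fin r)))
      (fun j => T.adj x (i, j))
    rw [Finset.card_univ, Fintype.card_fin] at h4
    rw [hti, Finset.sum_ite, Finset.sum_const, Finset.sum_const, fac, ← h3]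
    have h5 : (r:ℝ) - T.outDegIn x i
        = ((Finset.univ.filter (fun j => ¬ T.adj x (i, j))).card : ℝ) := by
      rw [h3]
      have h6 := congrArg (Nat.cast (R := ℝ)) h4
      push_cast at h6
      linarith
    rw [h5]
    simp only [map_natCast, nsmul_eq_mul, mul_one]
    ring
  have hL : L q (∑ f ∈ Fintype.piFinset t, (X : ℝ[X]) ^ n f)
      = (((Fintype.piFinset t).filter (fun f => n f ≤ q)).card : ℝ) := by
    unfold L
    simp only [finsetSum_coeff, coeff_X_pow]
    rw [Finset.sum_comm, Finset.card_filter]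
    push_cast
    refine Finset.sum_congr rfl fun f _ => ?_
    rw [Finset.sum_ite_eq']
    simp
  rw [hpoly, hL]
  norm_cast
  rw [Nat.card_eq_fintype_card, Fintype.card_subtype]
  refine le_trans (Finset.card_le_card (t := Finset.image
    (fun f : Fin c → Fin r => Finset.univ.image (fun i => (i, f i)))
    ((Fintype.piFinset t).filter (fun f => n f ≤ q))) ?_) Finset.card_image_le
  intro S hS
  simp only [Finset.mem_filter, Finset.mem_univ, true_and] at hS
  obtain ⟨hT, hxS, hq⟩ := hS
  choose v hv using fun i => Finset.card_eq_one.1 (hT i)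
  have hv1 : ∀ i, v i ∈ S ∧ (v i).1 = i := by
    intro i
    have : v i ∈ S.filter (fun v => v.1 = i) := by rw [hv i]; simp
    simpa using this
  have hv2 : ∀ y ∈ S, y = v y.1 := by
    intro y hy
    have : y ∈ S.filter (fun v => v.1 = y.1) := by simp [hy]
    rw [hv] at this
    simpa using this
  have hv3 : ∀ i, (i, (v i).2) = v i := fun i => Prod.ext (hv1 i).2.symm rfl
  rw [Finset.mem_image]
  refine ⟨fun i => (v i).2, ?_, ?_⟩
  · rw [Finset.mem_filter, Fintype.mem_piFinset]
    refine ⟨fun i => ?_, le_trans ?_ hq⟩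
    · by_cases hi : i = x.1
      · subst hi
        simp [ht, ← hv2 x hxS]
      · simp [ht, hi]
    · rw [MPT.outDegOn, Nat.card_eq_fintype_card, Fintype.card_subtype, hn]
      refine Finset.card_le_card_of_injOn v ?_ ?_
      · intro i hi
        simp only [hv3, Finset.coe_filter, Finset.mem_univ, true_and, Set.mem_ofPred_eq] at hi ⊢
        exact ⟨(hv1 i).1, hi⟩
      · intro i _ j _ hij
        rw [← (hv1 i).2, hij, (hv1 j).2]
  · ext y
    simp only [hv3, Finset.mem_image, Finset.mem_univ, true_and]
    constructor
    · rintro ⟨i, rfl⟩; exact (hv1 i).1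
    · intro hy; exact ⟨y.1, (hv2 y hy).symm⟩

open scoped Classical in
lemma outDeg_eq {c r : ℕ} (T : MPT c r) (x : Fin c × Fin r) :
    T.outDeg x = ∑ i, T.outDegIn x i := by
  unfold MPT.outDeg MPT.outDegIn
  simp only [Nat.card_eq_fintype_card, Fintype.card_subtype, Finset.card_filter]
  rw [Fintype.sum_prod_type]

open scoped Classical in
lemma inDeg_eq {c r : ℕ} (T : MPT c r) (x : Fin c × Fin r) :
    T.inDeg x = ∑ i, T.inDegIn x i := by
  unfold MPT.inDeg MPT.inDegIn
  simp only [Nat.card_eq_fintype_card, Fintype.card_subtype, Finset.card_filter]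
  rw [Fintype.sum_prod_type]

open scoped Classical in
lemma deg_add {c r : ℕ} (T : MPT c r) (x : Fin c × Fin r) (i : Fin c) (hi : i ≠ x.1) :
    T.outDegIn x i + T.inDegIn x i = r := by
  unfold MPT.inDegIn MPT.outDegIn
  simp only [Nat.card_eq_fintype_card, Fintype.card_subtype]
  have h4 := Finset.card_filter_add_card_filter_not (s := (Finset.univ : Finset (Fin r)))
      (fun j => T.adj x (i, j))
  rw [Finset.card_univ, Fintype.card_fin] at h4
  refine Eq.trans ?_ h4
  congr 2
  ext j
  simp only [Finset.mem_filter, Finset.mem_univ, true_and]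
  exact T.adj_iff (i, j) x hi

lemma out_self {c r : ℕ} (T : MPT c r) (x : Fin c × Fin r) : T.outDegIn x x.1 = 0 := by
  unfold MPT.outDegIn
  have : IsEmpty {j // T.adj x (x.1, j)} :=
    ⟨fun j => T.not_adj_same_part x (x.1, j.1) rfl j.2⟩
  simp

lemma in_self {c r : ℕ} (T : MPT c r) (x : Fin c × Fin r) : T.inDegIn x x.1 = 0 := by
  unfold MPT.inDegIn
  have : IsEmpty {j // T.adj (x.1, j) x} :=
    ⟨fun j => T.not_adj_same_part (x.1, j.1) x rfl j.2⟩
  simp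

lemma out_le_mu {c r : ℕ} (T : MPT c r) (x : Fin c × Fin r) (i : Fin c) :
    T.outDegIn x i ≤ T.mu := by
  have h0 : T.minOutV = 0 := by
    have h1 : T.minOutV ≤ ⨅ i, T.outDegIn x i := ciInf_le' _ x
    have h2 : ⨅ i, T.outDegIn x i ≤ T.outDegIn x x.1 := ciInf_le' _ x.1
    rw [out_self] at h2
    omega
  have h1 : T.outDegIn x i ≤ ⨆ i, T.outDegIn x i :=
    le_ciSup (f := fun i => T.outDegIn x i) (Set.finite_range _).bddAbove i
  have h2 : ⨆ i, T.outDegIn x i ≤ T.maxOutV :=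
    le_ciSup (f := fun x => ⨆ i, T.outDegIn x i) (Set.finite_range _).bddAbove x
  unfold MPT.mu
  omega

end TPB

/-- if `δ(G_{r,c}) ≥ ⌊(c−2)/4⌋·(r + μ) + max{δ_V⁺, δ_V⁻}`, then for
every vertex `x`,
`T⁺(x) ≤ (1/(c−1)^(c−1)) · Σ_{k=0}^{⌊(c−2)/4⌋} C(c−1,k) d⁺(x)^k d⁻(x)^(c−1−k)`. -/
theorem Tplus_upper_bound
    (c r : ℕ) (T : MPT c r)
    (hδ : T.minDeg ≥ ((c - 2) / 4) * (r + T.mu) + max T.minOutV T.minInV)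
    (x : Fin c × Fin r) :
    (T.Tplus x : ℝ) ≤
      (1 / ((c : ℝ) - 1) ^ (c - 1)) *
        ∑ k ∈ Finset.range ((c - 2) / 4 + 1),
          ((c - 1).choose k : ℝ) * (T.outDeg x : ℝ) ^ k *
            (T.inDeg x : ℝ) ^ (c - 1 - k) := by
  have hc : 0 < c := x.1.pos
  have hr : 0 < r := x.2.pos
  have hcard : (Finset.univ.erase x.1).card = c - 1 := by simp
  have hR : (0:ℝ) < r := by exact_mod_cast hr
  have hcast : ((c - 1 : ℕ) : ℝ) = (c:ℝ) - 1 := by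
    rw [Nat.cast_sub (by omega)]; simp
  have hout : (T.outDeg x : ℝ) = ∑ i ∈ Finset.univ.erase x.1, (T.outDegIn x i : ℝ) := by
    rw [TPB.outDeg_eq, ← Finset.add_sum_erase _ _ (Finset.mem_univ x.1), TPB.out_self]
    push_cast; ring
  have hadd : ∀ i ∈ Finset.univ.erase x.1, (T.outDegIn x i : ℝ) + T.inDegIn x i = r := by
    intro i hi
    exact_mod_cast TPB.deg_add T x i (Finset.mem_erase.1 hi).1
  have hin : (T.outDeg x : ℝ) + T.inDeg x = ((c:ℝ) - 1) * r := by
    rw [hout, TPB.inDeg_eq, ← Finset.add_sum_erase _ _ (Finset.mem_univ x.1), TPB.in_self]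
    push_cast
    rw [zero_add, ← Finset.sum_add_distrib, Finset.sum_congr rfl hadd, Finset.sum_const, hcard,
      nsmul_eq_mul, hcast]
  have hdeg : (((c-2)/4 : ℕ) : ℝ) * ((r:ℝ) + T.mu) ≤ T.outDeg x := by
    have h1 : T.minDeg ≤ min (T.outDeg x) (T.inDeg x) := ciInf_le' _ x
    have h2 : (c-2)/4 * (r + T.mu) ≤ T.outDeg x := by omega
    exact_mod_cast h2
  have hcount := TPB.count T x ((c-2)/4)
  refine hcount.trans ?_
  rcases Nat.lt_or_ge 1 c with hc1 | hc1
  · have hpos : (0:ℝ) < (c:ℝ) - 1 := by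
      have : (1:ℝ) < c := by exact_mod_cast hc1
      linarith
    have hs := TPB.smooth (r:ℝ) (T.mu : ℝ) ((T.outDeg x : ℝ) / ((c:ℝ) - 1)) hR ((c-2)/4)
      (Finset.univ.erase x.1) (by intro h; rw [hcard]; omega) _
      (fun i => (T.outDegIn x i : ℝ)) le_rfl
      (by
        intro i hi
        have h1 := hadd i hi
        have h2 : (0:ℝ) ≤ T.inDegIn x i := by positivity
        refine ⟨by positivity, by linarith, ?_⟩
        exact_mod_cast TPB.out_le_mu T x i)
      (by rw [← hout, hcard, hcast]; field_simp)
      (by rw [← hout]; exact hdeg)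
    refine hs.trans (le_of_eq ?_)
    rw [TPB.L_pow, hcard, Finset.mul_sum]
    refine Finset.sum_congr rfl fun k hk => ?_
    have hk' : k ≤ c - 1 := by
      have := Finset.mem_range.1 hk
      omega
    have hsub : (r:ℝ) - (T.outDeg x : ℝ) / ((c:ℝ) - 1) = (T.inDeg x : ℝ) / ((c:ℝ) - 1) := by
      rw [eq_div_iff hpos.ne', sub_mul, div_mul_cancel₀ _ hpos.ne']
      linarith
    rw [hsub, div_pow, div_pow]
    have hpw : ((c:ℝ) - 1) ^ (c - 1) = ((c:ℝ) - 1) ^ k * ((c:ℝ) - 1) ^ (c - 1 - k) := by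
      rw [← pow_add]; congr 1; omega
    rw [hpw]
    field_simp
  · have : c = 1 := by omega
    subst this
    have he : (Finset.univ.erase x.1) = ∅ := Finset.card_eq_zero.1 (by rw [hcard])
    rw [he]
    simp [TPB.pr, TPB.L]
end

section
/- Let G_{r,c} be a balanced c-partite tournament with c ≥ 10 such that δ(G_{r,c}) ≥ r(c−1)(c+6)/(4(c+1)), let x be any vertex, and set q = ⌊(c−2)/4⌋. If d^+(x) ≥ d^−(x), then Σ_{k=0}^{q} C(c−1,k) (d^+(x)/d^−(x))^k < C(c−1, q) · ((3c−2)/(2c−4)) · (d^+(x)/d^−(x))^q; and if d^+(x) < d^−(x), then Σ_{k=0}^{q} C(c−1,k) (d^+(x)/d^−(x))^k < C(c−1, q) · ((3c−2)/(2c−4)) · (d^−(x)/d^+(x))^q. (Note that the degree hypothesis forces d^+(x) > 0 and d^−(x) > 0.) -/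
open Finset

theorem aux_sum (c : ℕ) (hc : 10 ≤ c) (t : ℝ) (ht : 1 ≤ t) (q : ℕ) (hq : 4 * q + 2 ≤ c) :
    (2 * (c : ℝ) + 4) * ∑ k ∈ Finset.range (q + 1), ((c - 1).choose k : ℝ) * t ^ k
      ≤ (3 * (c : ℝ) + 2) * (((c - 1).choose q : ℝ) * t ^ q) := by
  have hcR : (10 : ℝ) ≤ c := by exact_mod_cast hc
  induction q with
  | zero => simp; linarith
  | succ q ih =>
    rw [Finset.sum_range_succ, mul_add]
    have ih' := ih (by omega)
    have h1 : ((c - 1).choose (q + 1) : ℝ) * ((q : ℝ) + 1) =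
        ((c - 1).choose q : ℝ) * ((c : ℝ) - 1 - q) := by
      have h := Nat.choose_succ_right_eq (c - 1) q
      have h2 : ((c - 1 - q : ℕ) : ℝ) = (c : ℝ) - 1 - q := by
        rw [Nat.cast_sub (by omega), Nat.cast_sub (by omega)]; simp
      rw [← h2]
      exact_mod_cast h
    have hqR : 4 * ((q : ℝ) + 1) + 2 ≤ c := by exact_mod_cast hq
    have hA : (0 : ℝ) ≤ ((c - 1).choose q : ℝ) := by positivity
    have hB : (0 : ℝ) ≤ ((c - 1).choose (q + 1) : ℝ) := by positivity
    generalize ((c - 1).choose q : ℝ) = A at *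
    generalize ((c - 1).choose (q + 1) : ℝ) = B at *
    have hq0 : (0 : ℝ) < (q : ℝ) + 1 := by positivity
    have h3 : (3 * (c : ℝ) + 2) * A ≤ ((c : ℝ) - 2) * B := by
      have h5 : (3 * (c : ℝ) + 2) * ((q : ℝ) + 1) ≤ ((c : ℝ) - 2) * ((c : ℝ) - 1 - q) := by
        nlinarith
      have h6 : (3 * (c : ℝ) + 2) * A * ((q : ℝ) + 1) ≤ ((c : ℝ) - 2) * B * ((q : ℝ) + 1) := by
        have := mul_le_mul_of_nonneg_left h5 hA
        have h7 : ((c : ℝ) - 2) * B * ((q : ℝ) + 1) = ((c : ℝ) - 2) * (A * ((c : ℝ) - 1 - q)) := by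
          rw [← h1]; ring
        rw [h7]; linarith
      exact le_of_mul_le_mul_right h6 hq0
    have htq : 0 ≤ t ^ q := by positivity
    have h4 : t ^ q ≤ t ^ (q + 1) := pow_le_pow_right₀ ht (by omega)
    have h8 : (3 * (c : ℝ) + 2) * A * t ^ q ≤ ((c : ℝ) - 2) * B * t ^ (q + 1) :=
      mul_le_mul h3 h4 htq (mul_nonneg (by linarith) hB)
    linarith

theorem aux_lt (c : ℕ) (hc : 10 ≤ c) (t : ℝ) (ht : 1 ≤ t) :
    ∑ k ∈ Finset.range ((c - 2) / 4 + 1), ((c - 1).choose k : ℝ) * t ^ k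
      < ((c - 1).choose ((c - 2) / 4) : ℝ) *
            ((3 * (c : ℝ) - 2) / (2 * (c : ℝ) - 4)) * t ^ ((c - 2) / 4) := by
  have hcR : (10 : ℝ) ≤ c := by exact_mod_cast hc
  have h := aux_sum c hc t ht ((c - 2) / 4) (by omega)
  have hA : (0 : ℝ) < ((c - 1).choose ((c - 2) / 4) : ℝ) := by
    exact_mod_cast Nat.choose_pos (by omega)
  have hP : (0 : ℝ) < ((c - 1).choose ((c - 2) / 4) : ℝ) * t ^ ((c - 2) / 4) := by positivity
  have h1 : (3 * (c : ℝ) + 2) / (2 * c + 4) < (3 * (c : ℝ) - 2) / (2 * (c : ℝ) - 4) := by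
    rw [div_lt_div_iff₀ (by linarith) (by linarith)]
    nlinarith
  have h2 := mul_lt_mul_of_pos_right h1 hP
  have h3 : ∑ k ∈ Finset.range ((c - 2) / 4 + 1), ((c - 1).choose k : ℝ) * t ^ k ≤
      (3 * (c : ℝ) + 2) / (2 * c + 4) *
        (((c - 1).choose ((c - 2) / 4) : ℝ) * t ^ ((c - 2) / 4)) := by
    rw [div_mul_eq_mul_div, le_div_iff₀ (by linarith)]
    linarith
  calc _ ≤ _ := h3
    _ < _ := h2
    _ = _ := by ring

/-- if `c ≥ 10` and `δ(G_{r,c}) ≥ r(c−1)(c+6)/(4(c+1))`, then for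
every vertex `x` and `q = ⌊(c−2)/4⌋`:
if `d⁺(x) ≥ d⁻(x)` then
`Σ_{k=0}^{q} C(c−1,k)(d⁺(x)/d⁻(x))^k < C(c−1,q)·((3c−2)/(2c−4))·(d⁺(x)/d⁻(x))^q`,
and if `d⁺(x) < d⁻(x)` then
`Σ_{k=0}^{q} C(c−1,k)(d⁺(x)/d⁻(x))^k < C(c−1,q)·((3c−2)/(2c−4))·(d⁻(x)/d⁺(x))^q`. -/
theorem sum_binomial_ratio_bound
    (c r : ℕ) (hc : 10 ≤ c) (hr : 1 ≤ r) (T : MPT c r)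
    (hδ : (T.minDeg : ℝ) ≥
      (r : ℝ) * ((c : ℝ) - 1) * (((c : ℝ) + 6) / (4 * ((c : ℝ) + 1))))
    (x : Fin c × Fin r) :
    (T.outDeg x ≥ T.inDeg x →
      ∑ k ∈ Finset.range ((c - 2) / 4 + 1),
          ((c - 1).choose k : ℝ) * ((T.outDeg x : ℝ) / (T.inDeg x : ℝ)) ^ k
        < ((c - 1).choose ((c - 2) / 4) : ℝ) *
            ((3 * (c : ℝ) - 2) / (2 * (c : ℝ) - 4)) *
            ((T.outDeg x : ℝ) / (T.inDeg x : ℝ)) ^ ((c - 2) / 4)) ∧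
    (T.outDeg x < T.inDeg x →
      ∑ k ∈ Finset.range ((c - 2) / 4 + 1),
          ((c - 1).choose k : ℝ) * ((T.outDeg x : ℝ) / (T.inDeg x : ℝ)) ^ k
        < ((c - 1).choose ((c - 2) / 4) : ℝ) *
            ((3 * (c : ℝ) - 2) / (2 * (c : ℝ) - 4)) *
            ((T.inDeg x : ℝ) / (T.outDeg x : ℝ)) ^ ((c - 2) / 4)) := by
  have hcR : (10 : ℝ) ≤ c := by exact_mod_cast hc
  have hrR : (1 : ℝ) ≤ r := by exact_mod_cast hr
  have hpos : 0 < T.minDeg := by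
    have : (0 : ℝ) < T.minDeg := by
      refine lt_of_lt_of_le ?_ hδ
      have : (0 : ℝ) < (c : ℝ) - 1 := by linarith
      positivity
    exact_mod_cast this
  have hle : T.minDeg ≤ min (T.outDeg x) (T.inDeg x) :=
    ciInf_le' (fun x => min (T.outDeg x) (T.inDeg x)) x
  have ho : 0 < T.outDeg x := by omega
  have hi : 0 < T.inDeg x := by omega
  have hoR : (0 : ℝ) < T.outDeg x := by exact_mod_cast ho
  have hiR : (0 : ℝ) < T.inDeg x := by exact_mod_cast hi
  constructor
  · intro h
    apply aux_lt c hc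
    rw [le_div_iff₀ hiR, one_mul]
    exact_mod_cast h
  · intro h
    have hR : (T.outDeg x : ℝ) ≤ T.inDeg x := by exact_mod_cast h.le
    have h1 : (1 : ℝ) ≤ (T.inDeg x : ℝ) / (T.outDeg x : ℝ) := by
      rw [le_div_iff₀ hoR, one_mul]; exact hR
    have h2 : (T.outDeg x : ℝ) / (T.inDeg x : ℝ) ≤ (T.inDeg x : ℝ) / (T.outDeg x : ℝ) :=
      le_trans ((div_le_one hiR).2 hR) h1
    refine lt_of_le_of_lt ?_ (aux_lt c hc _ h1)
    gcongr
end

section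
/- Let G_{r,c} be a balanced c-partite tournament with c ≥ 10, and set α = 2Δ(G_{r,c})/(r(c−1)) and β = 2δ(G_{r,c})/(r(c−1)). If 1/r ≥ √c · (9/7) · (2/3^(3/4))^(c−1) · (α/β)^{⌊(c−2)/4⌋} · (α^(c−1) + β^(c−1)), and δ(G_{r,c}) ≥ max{ r(c−1)(c+6)/(4(c+1)), ⌊(c−2)/4⌋·(r + μ(G_{r,c})) + max{δ_V^+, δ_V^−} }, then G_{r,c} has a strong partition. -/
open Finset

namespace SPAux

lemma amgm {ι : Type*} (s : Finset ι) (y : ι → ℝ) (Q : ℝ) (hQ : 0 < Q)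
    (h0 : ∀ k ∈ s, 0 ≤ y k) (hs : ∑ k ∈ s, y k ≤ s.card * Q) :
    ∏ k ∈ s, y k ≤ Q ^ s.card := by
  have h1 : ∏ k ∈ s, y k ≤ ∏ k ∈ s, (Q * Real.exp (y k / Q - 1)) := by
    apply Finset.prod_le_prod h0
    intro k _
    have := Real.add_one_le_exp (y k / Q - 1)
    calc y k = Q * (y k / Q - 1 + 1) := by field_simp; ring
      _ ≤ _ := by gcongr
  refine h1.trans ?_
  rw [Finset.prod_mul_distrib, Finset.prod_const, ← Real.exp_sum]
  have : Real.exp (∑ k ∈ s, (y k / Q - 1)) ≤ 1 := by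
    rw [Real.exp_le_one_iff, Finset.sum_sub_distrib, ← Finset.sum_div]
    simp only [sum_const, nsmul_eq_mul, mul_one, sub_nonpos]
    rwa [div_le_iff₀ hQ]
  exact mul_le_of_le_one_right (by positivity) this

open scoped Classical in
lemma expect {c r : ℕ} (A : Fin c × Fin r → Fin c × Fin r → Prop)
    (hA : ∀ u v : Fin c × Fin r, u.1 = v.1 → ¬ A u v) (D : ℝ) (hc : 10 ≤ c)
    (hD : ∀ x, D ≤ (Nat.card {y // A x y} : ℝ))
    (hQ : 0 < (r : ℝ) - 2 * D / (3 * (c - 1))) (i : Fin c) :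
    ∑ t : Fin c → Fin r, ∏ k, (if A (i, t i) (k, t k) then (1/3 : ℝ) else 1)
      ≤ r * ((r : ℝ) - 2 * D / (3 * (c - 1))) ^ (c - 1) := by
  set Q := (r : ℝ) - 2 * D / (3 * (c - 1)) with hQd
  let F : Fin r → Fin c → Fin r → ℝ := fun a k b =>
    if k = i then (if b = a then 1 else 0) else (if A (i, a) (k, b) then (1/3 : ℝ) else 1)
  have hc' : (0:ℝ) < (c:ℝ) - 1 := by
    have : (10:ℝ) ≤ c := by exact_mod_cast hc
    linarith
  have h1 : ∀ t : Fin c → Fin r, ∏ k, (if A (i, t i) (k, t k) then (1/3 : ℝ) else 1)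
      = ∑ a, ∏ k, F a k (t k) := by
    intro t
    rw [Finset.sum_eq_single (t i)]
    · apply Finset.prod_congr rfl
      intro k _
      by_cases hk : k = i
      · subst hk
        simp [F, hA (k, t k) (k, t k) rfl]
      · simp [F, hk]
    · intro a _ ha
      apply Finset.prod_eq_zero (Finset.mem_univ i)
      simp [F, Ne.symm ha]
    · simp
  simp_rw [h1]
  rw [Finset.sum_comm]
  have h2 : ∀ a, ∑ t : Fin c → Fin r, ∏ k, F a k (t k) ≤ Q ^ (c - 1) := by
    intro a
    have h3 : ∑ t : Fin c → Fin r, ∏ k, F a k (t k) = ∏ k, ∑ b, F a k b := by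
      rw [Finset.prod_univ_sum, Fintype.piFinset_univ]
    rw [h3, ← Finset.mul_prod_erase _ _ (Finset.mem_univ i)]
    have h4 : ∑ b, F a i b = 1 := by simp [F]
    rw [h4, one_mul]
    have hcard : (univ.erase i).card = c - 1 := by simp
    rw [← hcard]
    have h5 : ∀ k ∈ univ.erase i, ∑ b, F a k b
        = r - 2 / 3 * ∑ b, (if A (i, a) (k, b) then (1:ℝ) else 0) := by
      intro k hk
      have hk : k ≠ i := (Finset.mem_erase.1 hk).1
      have : (r : ℝ) = ∑ b : Fin r, (1:ℝ) := by simp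
      rw [this, Finset.mul_sum, ← Finset.sum_sub_distrib]
      apply Finset.sum_congr rfl
      intro b _
      simp only [F, hk, if_false]
      split_ifs <;> norm_num
    apply amgm _ _ _ hQ
    · intro k _
      apply Finset.sum_nonneg
      intro b _
      simp only [F]
      split_ifs <;> norm_num
    · rw [Finset.sum_congr rfl h5, Finset.sum_sub_distrib, ← Finset.mul_sum]
      have h6 : ∑ k ∈ univ.erase i, ∑ b, (if A (i, a) (k, b) then (1:ℝ) else 0)
          = Nat.card {y // A (i, a) y} := by
        rw [Nat.card_eq_fintype_card, Fintype.card_subtype, Finset.card_filter]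
        push_cast
        rw [Fintype.sum_prod_type, ← Finset.add_sum_erase _ _ (Finset.mem_univ i)]
        have : ∀ b, ¬ A (i, a) (i, b) := fun b => hA _ _ rfl
        simp [this]
      rw [h6, hcard]
      have := hD (i, a)
      simp only [sum_const, hcard, nsmul_eq_mul]
      rw [Nat.cast_sub (by omega), hQd, mul_sub]
      have e : ((c:ℝ) - (1:ℕ)) * (2 * D / (3 * (c - 1))) = 2 / 3 * D := by
        push_cast
        field_simp
      rw [e]
      linarith
  calc _ ≤ ∑ a : Fin r, Q ^ (c - 1) := Finset.sum_le_sum fun a _ => h2 a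
    _ = _ := by simp

open scoped Classical in
/-- the weight bound for one closed set -/
lemma closed_weight {c : ℕ} (hc : 10 ≤ c) (R : Fin c → Fin c → Prop)
    (hirr : ∀ i, ¬ R i i) (htour : ∀ i k, i ≠ k → (R i k ↔ ¬ R k i))
    (A : Finset (Fin c)) (hne : A.Nonempty) (hcard : 2 * A.card ≤ c)
    (hcl : ∀ i ∈ A, ∀ k, R i k → k ∈ A) :
    (c / 2 : ℝ) * Real.exp (- Real.log 3 * (c - 2) / 4) ≤
      ∑ i ∈ A, ∏ k, (if R i k then (1/3 : ℝ) else 1) := by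
  set L := Real.log 3 with hL
  have hL1 : 1 ≤ L := by
    rw [hL, Real.le_log_iff_exp_le (by norm_num)]
    linarith [Real.exp_one_lt_d9]
  let d : Fin c → ℝ := fun i => ∑ k ∈ A, (if R i k then (1:ℝ) else 0)
  have hw : ∀ i ∈ A, ∏ k, (if R i k then (1/3 : ℝ) else 1) = Real.exp (- L * d i) := by
    intro i hi
    have : d i = ∑ k, (if R i k then (1:ℝ) else 0) := by
      apply Finset.sum_subset (Finset.subset_univ _)
      intro k _ hk
      rw [if_neg]
      exact fun h => hk (hcl i hi k h)
    rw [this, Finset.mul_sum, Real.exp_sum]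
    apply Finset.prod_congr rfl
    intro k _
    split_ifs
    · rw [mul_one, Real.exp_neg, hL, Real.exp_log (by norm_num)]; norm_num
    · simp
  rw [Finset.sum_congr rfl hw]
  set b : ℝ := (A.card : ℝ) with hb
  have hb1 : 1 ≤ b := by
    rw [hb]; exact_mod_cast hne.card_pos
  have hbc : 2 * b ≤ c := by rw [hb]; exact_mod_cast hcard
  have hsum : 2 * ∑ i ∈ A, d i = b * (b - 1) := by
    have e1 : ∑ i ∈ A, d i = ∑ i ∈ A, ∑ k ∈ A, (if R k i then (1:ℝ) else 0) := by
      simp only [d]; exact Finset.sum_comm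
    have e2 : ∀ i ∈ A, ∀ k ∈ A, (if R i k then (1:ℝ) else 0) + (if R k i then (1:ℝ) else 0)
        = 1 - (if i = k then 1 else 0) := by
      intro i _ k _
      by_cases h : i = k
      · subst h; simp [hirr]
      · have := htour i k h
        by_cases h' : R k i
        · simp [h, h', this]
        · simp [h, h', this]
    have e3 : 2 * ∑ i ∈ A, d i = ∑ i ∈ A, ∑ k ∈ A,
        ((if R i k then (1:ℝ) else 0) + (if R k i then (1:ℝ) else 0)) := by
      simp only [Finset.sum_add_distrib]
      rw [← e1]; simp only [d]; ring
    rw [e3, Finset.sum_congr rfl (fun i hi => Finset.sum_congr rfl (e2 i hi))]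
    have e4 : ∀ i ∈ A, ∑ k ∈ A, ((1:ℝ) - (if i = k then 1 else 0)) = b - 1 := by
      intro i hi
      rw [Finset.sum_sub_distrib, Finset.sum_ite_eq]
      simp [hi, hb]
    rw [Finset.sum_congr rfl e4, Finset.sum_const, nsmul_eq_mul]
  have hJ : b * Real.exp (-L * ((b - 1) / 2)) ≤ ∑ i ∈ A, Real.exp (- L * d i) := by
    set m := (b - 1) / 2 with hm
    have h1 : ∀ i ∈ A, Real.exp (-L * m) * (1 - L * (d i - m)) ≤ Real.exp (-L * d i) := by
      intro i _
      have e : Real.exp (-L * d i) = Real.exp (-L * m) * Real.exp (-L * (d i - m)) := by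
        rw [← Real.exp_add]; ring_nf
      rw [e]
      have := Real.add_one_le_exp (-L * (d i - m))
      gcongr
      linarith
    refine le_trans ?_ (Finset.sum_le_sum h1)
    rw [← Finset.mul_sum, Finset.sum_sub_distrib, ← Finset.mul_sum, Finset.sum_sub_distrib]
    simp only [sum_const, nsmul_eq_mul, mul_one]
    rw [← hb]
    have : ∑ i ∈ A, d i - b * m = 0 := by rw [hm]; linarith
    rw [this]
    apply le_of_eq; ring
  refine le_trans ?_ hJ
  set x : ℝ := c / 2 with hx
  have hx5 : 5 ≤ x := by
    have : (10:ℝ) ≤ c := by exact_mod_cast hc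
    rw [hx]; linarith
  have hbx : b ≤ x := by rw [hx]; linarith
  have key : x ≤ b * Real.exp (L * ((x - b) / 2)) := by
    have hm : Real.exp ((x - b) / 2) ≤ Real.exp (L * ((x - b) / 2)) := by
      apply Real.exp_le_exp.2
      have : 0 ≤ (x - b) / 2 := by linarith
      nlinarith
    refine le_trans ?_ (mul_le_mul_of_nonneg_left hm (by linarith))
    by_cases h2 : 2 ≤ A.card
    · have h2 : (2:ℝ) ≤ b := by rw [hb]; exact_mod_cast h2
      have := Real.add_one_le_exp ((x - b) / 2)
      nlinarith
    · have : A.card = 1 := by have := hne.card_pos; omega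
      have hb' : b = 1 := by rw [hb, this]; norm_num
      rw [hb', one_mul]
      have := Real.quadratic_le_exp_of_nonneg (x := (x - 1) / 2) (by linarith)
      nlinarith
  have e1 : -L * (c - 2) / 4 = -L * ((x - 1) / 2) := by rw [hx]; ring
  have e2 : Real.exp (-L * ((b - 1) / 2)) =
      Real.exp (L * ((x - b) / 2)) * Real.exp (-L * ((x - 1) / 2)) := by
    rw [← Real.exp_add]; ring_nf
  rw [e1, e2, ← mul_assoc]
  gcongr

open scoped Classical in
lemma nonstrong_weight {c : ℕ} (hc : 10 ≤ c) (R : Fin c → Fin c → Prop)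
    (hirr : ∀ i, ¬ R i i) (htour : ∀ i k, i ≠ k → (R i k ↔ ¬ R k i))
    (u v : Fin c) (huv : ¬ Relation.ReflTransGen R u v) :
    (c / 2 : ℝ) * Real.exp (- Real.log 3 * (c - 2) / 4) ≤
      ∑ i, ∏ k, (if R i k then (1/3 : ℝ) else 1) +
      ∑ i, ∏ k, (if R k i then (1/3 : ℝ) else 1) := by
  have pos : ∀ (P : Fin c → Fin c → Prop) (s : Finset (Fin c)),
      0 ≤ ∑ i ∈ s, ∏ k, (if P i k then (1/3 : ℝ) else 1) := by
    intro P s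
    apply Finset.sum_nonneg; intro i _; apply Finset.prod_nonneg; intro k _
    split_ifs <;> norm_num
  have mono : ∀ (P : Fin c → Fin c → Prop) (s : Finset (Fin c)),
      ∑ i ∈ s, ∏ k, (if P i k then (1/3 : ℝ) else 1) ≤
      ∑ i, ∏ k, (if P i k then (1/3 : ℝ) else 1) := by
    intro P s
    apply Finset.sum_le_sum_of_subset_of_nonneg (Finset.subset_univ _)
    intro i _ _; apply Finset.prod_nonneg; intro k _
    split_ifs <;> norm_num
  let A : Finset (Fin c) := univ.filter (fun w => Relation.ReflTransGen R u w)
  have hcc : A.card + Aᶜ.card = c := by rw [Finset.card_add_card_compl]; simp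
  by_cases h : 2 * A.card ≤ c
  · have := closed_weight hc R hirr htour A ⟨u, by simp [A]; exact .refl⟩ h (by
      intro i hi k hik
      simp only [A, mem_filter, mem_univ, true_and] at hi ⊢
      exact hi.tail hik)
    linarith [mono R A, pos (fun i k => R k i) univ]
  · have := closed_weight hc (fun i k => R k i) hirr (fun i k hik => htour k i (Ne.symm hik)) Aᶜ
      ⟨v, by simp [A]; exact huv⟩ (by omega) (by
      intro i hi k hik
      simp only [A, mem_compl, mem_filter, mem_univ, true_and] at hi ⊢
      exact fun hk => hi (hk.tail hik))
    linarith [mono (fun i k => R k i) Aᶜ, pos R univ]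

def tr {c r : ℕ} (t : Fin c → Fin r) : Finset (Fin c × Fin r) :=
  univ.image (fun i => (i, t i))

lemma tr_trans {c r : ℕ} (t : Fin c → Fin r) : IsTransversal (tr t) := by
  intro i
  rw [Finset.card_eq_one]
  refine ⟨(i, t i), ?_⟩
  ext ⟨a, b⟩
  simp only [tr, mem_filter, mem_image, mem_univ, true_and, Prod.mk.injEq, mem_singleton]
  constructor
  · rintro ⟨⟨k, rfl, rfl⟩, rfl⟩; exact ⟨rfl, rfl⟩
  · rintro ⟨rfl, rfl⟩; exact ⟨⟨a, rfl, rfl⟩, rfl⟩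

lemma tr_strong {c r : ℕ} (T : MPT c r) (t : Fin c → Fin r)
    (h : ∀ u v, Relation.ReflTransGen (fun i k => T.adj (i, t i) (k, t k)) u v) :
    T.StrongOn (tr t) := by
  intro u hu v hv
  simp only [tr, mem_image, mem_univ, true_and] at hu hv
  obtain ⟨i, rfl⟩ := hu
  obtain ⟨k, rfl⟩ := hv
  have h' := h i k
  induction h' with
  | refl => exact .refl
  | tail _ hab ih => 
    refine ih.tail ?_
    exact ⟨by simp [tr], by simp [tr], hab⟩

open scoped Classical in
lemma partition_of_few {c r : ℕ} [NeZero r] (hc : 10 ≤ c) (T : MPT c r)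
    (h : r * (univ.filter (fun t : Fin c → Fin r => ¬ T.StrongOn (tr t))).card < r ^ c) :
    T.HasStrongPartition := by
  set N := univ.filter (fun t : Fin c → Fin r => ¬ T.StrongOn (tr t)) with hN
  have hex : ∃ s : Fin c → Fin r, ∀ j : Fin r, T.StrongOn (tr (fun i => j + s i)) := by
    by_contra hcon
    push Not at hcon
    choose j hj using hcon
    have hle : (univ : Finset (Fin c → Fin r)).card ≤ ((univ : Finset (Fin r)) ×ˢ N).card := by
      apply Finset.card_le_card_of_injOn (fun s => (j s, fun i => j s + s i))
      · intro s _
        simp [hN, hj s]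
      · intro s _ s' _ hss
        simp only [Prod.mk.injEq] at hss
        funext i
        have := congrFun hss.2 i
        rw [hss.1] at this
        exact add_left_cancel this
    rw [Finset.card_product] at hle
    simp at hle
    omega
  obtain ⟨s, hs⟩ := hex
  refine ⟨univ.image (fun j => tr (fun i => j + s i)), ⟨?_, ?_, ?_⟩, ?_⟩
  · intro S hS
    obtain ⟨j, _, rfl⟩ := Finset.mem_image.1 hS
    exact tr_trans _
  · intro S hS S' hS' hne
    obtain ⟨j, _, rfl⟩ := Finset.mem_image.1 hS
    obtain ⟨j', _, rfl⟩ := Finset.mem_image.1 hS'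
    rw [Finset.disjoint_left]
    rintro ⟨a, b⟩ h1 h2
    simp only [tr, mem_image, mem_univ, true_and, Prod.mk.injEq] at h1 h2
    obtain ⟨k, rfl, h1⟩ := h1
    obtain ⟨k', rfl, h2⟩ := h2
    apply hne
    have : j = j' := add_right_cancel (h1.trans h2.symm)
    rw [this]
  · rintro ⟨a, b⟩
    refine ⟨_, Finset.mem_image_of_mem _ (Finset.mem_univ (b - s a)), ?_⟩
    simp [tr]
  · intro S hS
    obtain ⟨j, _, rfl⟩ := Finset.mem_image.1 hS
    exact hs j

open scoped Classical in
lemma count_bound {c r : ℕ} (hc : 10 ≤ c) (T : MPT c r) (D : ℝ)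
    (hD1 : ∀ x, D ≤ (T.outDeg x : ℝ)) (hD2 : ∀ x, D ≤ (T.inDeg x : ℝ))
    (hQ : 0 < (r : ℝ) - 2 * D / (3 * (c - 1))) :
    (univ.filter (fun t : Fin c → Fin r => ¬ T.StrongOn (tr t))).card *
      ((c / 2 : ℝ) * Real.exp (- Real.log 3 * (c - 2) / 4)) ≤
      2 * c * r * ((r : ℝ) - 2 * D / (3 * (c - 1))) ^ (c - 1) := by
  set θ := (c / 2 : ℝ) * Real.exp (- Real.log 3 * (c - 2) / 4)
  let W : (Fin c → Fin r) → ℝ := fun t =>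
      ∑ i, ∏ k, (if T.adj (i, t i) (k, t k) then (1/3 : ℝ) else 1) +
      ∑ i, ∏ k, (if T.adj (k, t k) (i, t i) then (1/3 : ℝ) else 1)
  have hW0 : ∀ t, 0 ≤ W t := by
    intro t
    apply add_nonneg <;>
    · apply Finset.sum_nonneg; intro i _; apply Finset.prod_nonneg; intro k _
      split_ifs <;> norm_num
  have hW : ∀ t ∈ univ.filter (fun t : Fin c → Fin r => ¬ T.StrongOn (tr t)), θ ≤ W t := by
    intro t ht
    have ht := (Finset.mem_filter.1 ht).2
    have : ∃ u v, ¬ Relation.ReflTransGen (fun i k => T.adj (i, t i) (k, t k)) u v := by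
      by_contra hcon
      push Not at hcon
      exact ht (tr_strong T t hcon)
    obtain ⟨u, v, huv⟩ := this
    exact nonstrong_weight hc (fun i k => T.adj (i, t i) (k, t k))
      (fun i => T.not_adj_same_part _ _ rfl) (fun i k hik => T.adj_iff _ _ hik) u v huv
  calc _ = ∑ t ∈ univ.filter (fun t : Fin c → Fin r => ¬ T.StrongOn (tr t)), θ := by simp
    _ ≤ ∑ t ∈ univ.filter (fun t : Fin c → Fin r => ¬ T.StrongOn (tr t)), W t :=
        Finset.sum_le_sum hW
    _ ≤ ∑ t, W t := Finset.sum_le_sum_of_subset_of_nonneg (Finset.subset_univ _)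
        (fun t _ _ => hW0 t)
    _ = ∑ i, ∑ t : Fin c → Fin r, ∏ k, (if T.adj (i, t i) (k, t k) then (1/3 : ℝ) else 1) +
        ∑ i, ∑ t : Fin c → Fin r, ∏ k, (if T.adj (k, t k) (i, t i) then (1/3 : ℝ) else 1) := by
        simp only [W]
        rw [Finset.sum_add_distrib, Finset.sum_comm]
        congr 1
        rw [Finset.sum_comm]
    _ ≤ ∑ i : Fin c, r * ((r : ℝ) - 2 * D / (3 * (c - 1))) ^ (c - 1) +
        ∑ i : Fin c, r * ((r : ℝ) - 2 * D / (3 * (c - 1))) ^ (c - 1) := by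
        apply add_le_add
        · exact Finset.sum_le_sum fun i _ => expect T.adj T.not_adj_same_part D hc hD1 hQ i
        · exact Finset.sum_le_sum fun i _ => expect (fun x y => T.adj y x)
            (fun u v h => T.not_adj_same_part v u h.symm) D hc hD2 hQ i
    _ = _ := by simp; ring

open scoped Classical in
lemma deg_sum {c r : ℕ} (T : MPT c r) (x : Fin c × Fin r) :
    T.outDeg x + T.inDeg x + r = c * r := by
  unfold MPT.outDeg MPT.inDeg
  rw [Nat.card_eq_fintype_card, Nat.card_eq_fintype_card, Fintype.card_subtype,
    Fintype.card_subtype]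
  simp only [Finset.card_filter]
  rw [← Finset.sum_add_distrib]
  have h : ∀ y : Fin c × Fin r, ((if T.adj x y then 1 else 0) + (if T.adj y x then 1 else 0) : ℕ)
      + (if y.1 = x.1 then 1 else 0) = 1 := by
    intro y
    by_cases h : y.1 = x.1
    · simp [h, T.not_adj_same_part x y h.symm, T.not_adj_same_part y x h]
    · have := T.adj_iff y x h
      by_cases h' : T.adj x y <;> simp [h, h', this]
  have h2 : ∑ y : Fin c × Fin r, (if y.1 = x.1 then 1 else 0) = r := by
    rw [Fintype.sum_prod_type, Finset.sum_comm]
    simp only [Finset.sum_ite_eq', mem_univ, if_true]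
    simp
  have h3 := Finset.sum_congr (rfl : (univ : Finset (Fin c × Fin r)) = univ) (fun y _ => h y)
  rw [Finset.sum_add_distrib, h2] at h3
  simpa using h3

end SPAux

/-- Corollary: let `c ≥ 10`, `α = 2Δ/(r(c−1))`, `β = 2δ/(r(c−1))`.
If `1/r ≥ √c·(9/7)·(2/3^(3/4))^(c−1)·(α/β)^⌊(c−2)/4⌋·(α^(c−1)+β^(c−1))` and
`δ(G_{r,c}) ≥ max{r(c−1)(c+6)/(4(c+1)), ⌊(c−2)/4⌋(r+μ) + max{δ_V⁺, δ_V⁻}}`,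
then `G_{r,c}` has a strong partition. -/
theorem corollary_strong_partition
    (c r : ℕ) (hc : 10 ≤ c) (hr : 1 ≤ r) (T : MPT c r)
    (α β : ℝ)
    (hα : α = 2 * (T.maxDeg : ℝ) / ((r : ℝ) * ((c : ℝ) - 1)))
    (hβ : β = 2 * (T.minDeg : ℝ) / ((r : ℝ) * ((c : ℝ) - 1)))
    (h1r : 1 / (r : ℝ) ≥
      Real.sqrt c * (9 / 7) * (2 / (3 : ℝ) ^ ((3 : ℝ) / 4)) ^ (c - 1) *
        (α / β) ^ ((c - 2) / 4) * (α ^ (c - 1) + β ^ (c - 1)))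
    (hδ1 : (T.minDeg : ℝ) ≥
      (r : ℝ) * ((c : ℝ) - 1) * (((c : ℝ) + 6) / (4 * ((c : ℝ) + 1))))
    (hδ2 : T.minDeg ≥ ((c - 2) / 4) * (r + T.mu) + max T.minOutV T.minInV) :
    T.HasStrongPartition := by
  classical
  haveI : NeZero r := ⟨by omega⟩
  haveI : NeZero c := ⟨by omega⟩
  have hcR : (10:ℝ) ≤ c := by exact_mod_cast hc
  have hrR : (1:ℝ) ≤ r := by exact_mod_cast hr
  have hmin : ∀ x, T.minDeg ≤ min (T.outDeg x) (T.inDeg x) := fun x =>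
    ciInf_le (OrderBot.bddBelow _) x
  have hmax : ∀ x, max (T.outDeg x) (T.inDeg x) ≤ T.maxDeg := fun x =>
    le_ciSup (f := fun x => max (T.outDeg x) (T.inDeg x)) (Set.finite_range _).bddAbove x
  obtain ⟨x, hx⟩ : ∃ x, min (T.outDeg x) (T.inDeg x) = T.minDeg :=
    exists_eq_ciInf_of_finite (f := fun x => min (T.outDeg x) (T.inDeg x))
  have hsum := SPAux.deg_sum T x
  have hmx := hmax x
  have hΔδ : c * r ≤ T.maxDeg + T.minDeg + r := by
    rcases min_choice (T.outDeg x) (T.inDeg x) with h | h <;>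
    rcases max_le_iff.1 hmx with ⟨h1, h2⟩ <;> omega
  have hδΔ : 2 * T.minDeg + r ≤ c * r := by
    have := le_min_iff.1 (hmin x)
    omega
  have hΔδR : (c:ℝ) * r ≤ T.maxDeg + T.minDeg + r := by exact_mod_cast hΔδ
  have hδΔR : 2 * (T.minDeg:ℝ) + r ≤ c * r := by exact_mod_cast hδΔ
  have hrc : 0 < (r:ℝ) * (c - 1) := by nlinarith
  have hδpos : 0 < (T.minDeg : ℝ) := lt_of_lt_of_le (by positivity) hδ1
  have hβ0 : 0 < β := by rw [hβ]; positivity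
  have hβ1 : β ≤ 1 := by rw [hβ, div_le_one hrc]; linarith
  have hαβ : 2 ≤ α + β := by
    rw [hα, hβ, ← add_div, le_div_iff₀ hrc]; linarith
  have hα1 : 1 ≤ α := by linarith
  have hQe : (r : ℝ) - 2 * T.minDeg / (3 * (c - 1)) = r * (1 - β / 3) := by
    have : (c:ℝ) - 1 ≠ 0 := by linarith
    rw [hβ]; field_simp
  have hQ : 0 < (r : ℝ) - 2 * T.minDeg / (3 * (c - 1)) := by
    rw [hQe]; apply mul_pos <;> linarith
  have hcount := SPAux.count_bound hc T T.minDeg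
    (fun x => by exact_mod_cast (le_min_iff.1 (hmin x)).1)
    (fun x => by exact_mod_cast (le_min_iff.1 (hmin x)).2) hQ
  apply SPAux.partition_of_few hc T
  set N := (univ.filter (fun t : Fin c → Fin r => ¬ T.StrongOn (SPAux.tr t))).card
  rw [hQe] at hcount
  set E := Real.exp (Real.log 3 * (c - 2) / 4) with hE
  have hEpos : 0 < E := Real.exp_pos _
  have hE1 : Real.exp (-Real.log 3 * (c - 2) / 4) = E⁻¹ := by
    rw [hE, ← Real.exp_neg]; ring_nf
  rw [hE1] at hcount
  obtain ⟨n, rfl⟩ : ∃ n, c = n + 1 := ⟨c - 1, by omega⟩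
  simp only [Nat.add_sub_cancel] at hcount h1r
  -- bound on E
  set B : ℝ := 2 / (3 : ℝ) ^ ((3 : ℝ) / 4) with hB
  have hBpos : 0 < B := by positivity
  have hEB : E * (2 / 3) ^ n ≤ B ^ n := by
    have h3 : E ≤ ((3:ℝ) ^ ((1:ℝ) / 4)) ^ n := by
      rw [hE, Real.rpow_def_of_pos (by norm_num), ← Real.exp_nat_mul]
      apply Real.exp_le_exp.2
      have : 0 < Real.log 3 := Real.log_pos (by norm_num)
      push_cast
      nlinarith
    have h4 : B = (3:ℝ) ^ ((1:ℝ) / 4) * (2 / 3) := by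
      have : (3:ℝ) ^ ((1:ℝ) / 4) * (3:ℝ) ^ ((3:ℝ) / 4) = 3 := by
        rw [← Real.rpow_add (by norm_num)]; norm_num
      rw [hB, div_eq_iff (by positivity)]
      linear_combination (-2 / 3 : ℝ) * this
    rw [h4, mul_pow]
    gcongr
  have hq : (1 - β / 3) ^ n ≤ (2 / 3 : ℝ) ^ n * α ^ n := by
    rw [← mul_pow]
    apply pow_le_pow_left₀ <;> linarith
  have hsq : (28 / 9 : ℝ) < Real.sqrt ((n + 1 : ℕ) : ℝ) := by
    apply Real.lt_sqrt_of_sq_lt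
    linarith
  have hm : 1 ≤ (α / β) ^ ((n + 1 - 2) / 4) := by
    apply one_le_pow₀
    rw [le_div_iff₀ hβ0]; linarith
  have hαn : 0 < α ^ n := by positivity
  have hβn : 0 < β ^ n := by positivity
  have hfin : 4 * (B ^ n * α ^ n) * r < 1 := by
    have h5 : 4 * (B ^ n * α ^ n) < 1 / r := by
      refine lt_of_lt_of_le ?_ h1r
      calc 4 * (B ^ n * α ^ n) < (Real.sqrt ((n + 1 : ℕ) : ℝ) * (9 / 7)) * (B ^ n * α ^ n) := by
            apply mul_lt_mul_of_pos_right _ (by positivity)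
            linarith
        _ = Real.sqrt ((n + 1 : ℕ) : ℝ) * (9 / 7) * B ^ n * 1 * α ^ n := by ring
        _ ≤ _ := by
          gcongr
          linarith
    rwa [lt_div_iff₀ (by linarith)] at h5
  have hcp : (0:ℝ) < ((n + 1 : ℕ) : ℝ) := by linarith
  have hNb : (N : ℝ) ≤ r ^ (n + 1) * (4 * (E * (1 - β / 3) ^ n)) := by
    have h6 : (N : ℝ) * (((n + 1 : ℕ) : ℝ) / 2 * E⁻¹) ≤
        (r ^ (n + 1) * (4 * (E * (1 - β / 3) ^ n))) * (((n + 1 : ℕ) : ℝ) / 2 * E⁻¹) := by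
      refine hcount.trans (le_of_eq ?_)
      rw [mul_pow]
      field_simp
      ring
    exact le_of_mul_le_mul_right h6 (by positivity)
  have hlast : (r:ℝ) * N < r ^ (n + 1) := by
    have h7 : E * (1 - β / 3) ^ n ≤ B ^ n * α ^ n := by
      calc E * (1 - β / 3) ^ n ≤ E * ((2 / 3 : ℝ) ^ n * α ^ n) := by gcongr
        _ = (E * (2 / 3) ^ n) * α ^ n := by ring
        _ ≤ _ := by gcongr
    calc (r:ℝ) * N ≤ r * (r ^ (n + 1) * (4 * (B ^ n * α ^ n))) := by
          gcongr
          refine hNb.trans ?_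
          gcongr
      _ = r ^ (n + 1) * (4 * (B ^ n * α ^ n) * r) := by ring
      _ < r ^ (n + 1) * 1 := by
          apply mul_lt_mul_of_pos_left hfin
          positivity
      _ = _ := by ring
  exact_mod_cast hlast
end

section
/- Let G_{r,c} be a regular balanced c-partite tournament with c ≥ 10 (so every vertex has out-degree and in-degree equal to r(c−1)/2), and assume δ(G_{r,c}) ≥ ⌊(c−2)/4⌋·(r + μ(G_{r,c})) + max{δ_V^+, δ_V^−}. If 1/r ≥ √c · (18/7) · (2/3^(3/4))^(c−1), then G_{r,c} has a strong partition. -/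
open Finset

open scoped Classical in
theorem aux_prod_exp (c : ℕ) (A : Fin c → Fin c → Prop) (i : Fin c) :
    ∏ j, (if A i j then (1/3:ℝ) else 1) =
      Real.exp (-Real.log 3 * ∑ j, (if A i j then (1:ℝ) else 0)) := by
  rw [Finset.mul_sum, Real.exp_sum]
  refine Finset.prod_congr rfl fun j _ => ?_
  split_ifs
  · rw [mul_one, Real.exp_neg, Real.exp_log (by norm_num)]; norm_num
  · simp

open scoped Classical in
theorem aux_weight (c : ℕ) (A : Fin c → Fin c → Prop) (hA : ∀ i j, A i j → ¬ A j i)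
    (B : Finset (Fin c)) (hB : B.Nonempty) (hcl : ∀ i ∈ B, ∀ j, A i j → j ∈ B)
    (h2 : 2 * B.card ≤ c) :
    Real.exp (-Real.log 3 * (((c:ℝ) - 2) / 4)) * (((c:ℝ) + 2) / 4) ≤
      ∑ i, ∏ j, (if A i j then (1/3:ℝ) else 1) := by
  have hl : (1:ℝ) ≤ Real.log 3 := by
    rw [Real.le_log_iff_exp_le (by norm_num)]
    have := Real.exp_one_lt_d9
    linarith
  set l := Real.log 3 with hldef
  set m : ℝ := ((c:ℝ) - 2) / 4 with hm
  set O : Fin c → ℝ := fun i => ∑ j, (if A i j then (1:ℝ) else 0) with hO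
  have h1 : ∑ i ∈ B, ∏ j, (if A i j then (1/3:ℝ) else 1) ≤
      ∑ i, ∏ j, (if A i j then (1/3:ℝ) else 1) := by
    apply Finset.sum_le_sum_of_subset_of_nonneg (Finset.subset_univ _)
    intro i _ _
    apply Finset.prod_nonneg
    intro j _
    split_ifs <;> norm_num
  refine le_trans ?_ h1
  have h3 : ∑ i ∈ B, Real.exp (-l * m) * (1 - l * (O i - m)) ≤
      ∑ i ∈ B, ∏ j, (if A i j then (1/3:ℝ) else 1) := by
    apply Finset.sum_le_sum
    intro i _
    rw [aux_prod_exp]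
    have e : -l * ∑ j, (if A i j then (1:ℝ) else 0) = -l * m + (-l * (O i - m)) := by
      simp only [hO]; ring
    rw [← hldef, e, Real.exp_add]
    apply mul_le_mul_of_nonneg_left _ (Real.exp_pos _).le
    have := Real.add_one_le_exp (-l * (O i - m))
    linarith
  refine le_trans ?_ h3
  rw [← Finset.mul_sum]
  apply mul_le_mul_of_nonneg_left _ (Real.exp_pos _).le
  have hOB : ∀ i ∈ B, O i = ∑ j ∈ B, (if A i j then (1:ℝ) else 0) := by
    intro i hi
    simp only [hO]
    symm
    apply Finset.sum_subset (Finset.subset_univ _)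
    intro j _ hj
    rw [if_neg]
    intro h
    exact hj (hcl i hi j h)
  have hsum : 2 * ∑ i ∈ B, O i ≤ (B.card:ℝ) * B.card - B.card := by
    have e1 : ∑ i ∈ B, O i = ∑ i ∈ B, ∑ j ∈ B, (if A i j then (1:ℝ) else 0) :=
      Finset.sum_congr rfl hOB
    have e2 : ∑ i ∈ B, O i = ∑ i ∈ B, ∑ j ∈ B, (if A j i then (1:ℝ) else 0) := by
      rw [e1, Finset.sum_comm]
    have e3 : 2 * ∑ i ∈ B, O i =
        ∑ i ∈ B, ∑ j ∈ B, ((if A i j then (1:ℝ) else 0) + (if A j i then (1:ℝ) else 0)) := by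
      simp only [Finset.sum_add_distrib]
      rw [← e2, ← e1]; ring
    have e4 : ∑ i ∈ B, ∑ j ∈ B, ((if A i j then (1:ℝ) else 0) + (if A j i then (1:ℝ) else 0))
        ≤ ∑ i ∈ B, ∑ j ∈ B, ((1:ℝ) - if i = j then 1 else 0) := by
      apply Finset.sum_le_sum
      intro i _
      apply Finset.sum_le_sum
      intro j _
      have a1 := hA i j
      by_cases hij : i = j
      · subst hij
        have : ¬ A i i := fun h => hA i i h h
        simp [this]
      · by_cases p : A i j
        · simp [p, a1 p, hij]
        · by_cases q : A j i <;> simp [p, q, hij]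
    have e5 : ∑ i ∈ B, ∑ j ∈ B, ((1:ℝ) - if i = j then 1 else 0) =
        (B.card:ℝ) * B.card - B.card := by
      simp [Finset.sum_sub_distrib]
    linarith
  have hs : ∑ i ∈ B, (1 - l * (O i - m)) = (B.card:ℝ) - l * (∑ i ∈ B, O i) + l * m * B.card := by
    rw [Finset.sum_sub_distrib, ← Finset.mul_sum, Finset.sum_sub_distrib]
    simp
    ring
  rw [hs]
  have hs1 : (1:ℝ) ≤ B.card := by exact_mod_cast hB.card_pos
  have hs2 : 2 * (B.card:ℝ) ≤ c := by exact_mod_cast h2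
  set s : ℝ := (B.card:ℝ)
  have k1 : l * (∑ i ∈ B, O i) ≤ l * ((s * s - s) / 2) :=
    mul_le_mul_of_nonneg_left (by linarith) (by linarith)
  have k2 : 0 ≤ (l - 1) * (s * ((c:ℝ) - 2 * s)) :=
    mul_nonneg (by linarith) (mul_nonneg (by linarith) (by linarith))
  have k3 : 0 ≤ (s - 1) * ((c:ℝ) - 2 * s) := mul_nonneg (by linarith) (by linarith)
  have k4 : l * m * s - l * ((s * s - s) / 2) = l * (s * ((c:ℝ) - 2 * s)) / 4 := by
    simp only [hm]; ring
  nlinarith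

open scoped Classical in
theorem aux_average (c r : ℕ) (hr : 1 ≤ r)
    (R : Fin c × Fin r → Fin c × Fin r → Prop) (hR : ∀ x y, R x y → x.1 ≠ y.1)
    (hd : ∀ x, ∑ j, ∑ b, (if R x (j, b) then (1:ℝ) else 0) = (r:ℝ) * ((c:ℝ) - 1) / 2) :
    ∑ f : Fin c → Fin r, ∑ i, ∏ j, (if R (i, f i) (j, f j) then (1/3:ℝ) else 1) ≤
      (c:ℝ) * r * (2 * r / 3) ^ (c - 1) := by
  have hrpos : (0:ℝ) < r := by exact_mod_cast hr
  rw [Finset.sum_comm]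
  have main : ∀ i : Fin c, ∑ f : Fin c → Fin r,
      ∏ j, (if R (i, f i) (j, f j) then (1/3:ℝ) else 1) ≤ r * (2 * r / 3) ^ (c - 1) := by
    intro i
    set h : Fin r → Fin c → Fin r → ℝ := fun a j b =>
      if j = i then (if b = a then 1 else 0) else (if R (i, a) (j, b) then (1/3:ℝ) else 1) with hh
    have e1 : ∀ f : Fin c → Fin r, ∏ j, (if R (i, f i) (j, f j) then (1/3:ℝ) else 1) =
        ∑ a, ∏ j, h a j (f j) := by
      intro f
      rw [Finset.sum_eq_single (f i)]
      · refine Finset.prod_congr rfl fun j _ => ?_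
        by_cases hj : j = i
        · subst hj
          have : ¬ R (j, f j) (j, f j) := fun h => hR _ _ h rfl
          simp [hh, this]
        · simp [hh, hj]
      · intro a _ ha
        apply Finset.prod_eq_zero (Finset.mem_univ i)
        simp [hh, Ne.symm ha]
      · simp
    simp only [e1]
    rw [Finset.sum_comm]
    have e2 : ∀ a, ∑ f : Fin c → Fin r, ∏ j, h a j (f j) ≤ (2 * r / 3) ^ (c - 1) := by
      intro a
      have e3 : ∑ f : Fin c → Fin r, ∏ j, h a j (f j) = ∏ j, ∑ b, h a j b := by
        rw [Finset.prod_univ_sum]; simp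
      rw [e3, ← Finset.mul_prod_erase _ _ (Finset.mem_univ i)]
      have e4 : ∑ b, h a i b = 1 := by simp [hh]
      rw [e4, one_mul]
      have e5 : ∀ j ∈ Finset.univ.erase i, ∑ b, h a j b =
          (2 * r / 3) * ((3/2) - (∑ b, (if R (i, a) (j, b) then (1:ℝ) else 0)) / r) := by
        intro j hj
        have hj : j ≠ i := Finset.ne_of_mem_erase hj
        have : ∀ b, h a j b = 1 - (2/3) * (if R (i, a) (j, b) then (1:ℝ) else 0) := by
          intro b
          simp only [hh, hj, if_false]
          split_ifs <;> norm_num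
        simp only [this]
        rw [Finset.sum_sub_distrib, ← Finset.mul_sum]
        simp
        field_simp
      have hcard : (Finset.univ.erase i).card = c - 1 := by
        rw [Finset.card_erase_of_mem (Finset.mem_univ i)]; simp
      have hc1 : 1 ≤ c := by have := i.2; omega
      set y : Fin c → ℝ := fun j => (3/2) - (∑ b, (if R (i, a) (j, b) then (1:ℝ) else 0)) / r with hy
      have e6 : ∏ j ∈ Finset.univ.erase i, ∑ b, h a j b =
          (2 * r / 3) ^ (c - 1) * ∏ j ∈ Finset.univ.erase i, y j := by
        rw [Finset.prod_congr rfl e5, Finset.prod_mul_distrib, Finset.prod_const, hcard]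
      rw [e6]
      have y0 : ∀ j, 0 ≤ y j := by
        intro j
        have : (∑ b, (if R (i, a) (j, b) then (1:ℝ) else 0)) ≤ ∑ b : Fin r, (1:ℝ) := by
          apply Finset.sum_le_sum
          intro b _
          split_ifs <;> norm_num
        have h2 : (∑ b, (if R (i, a) (j, b) then (1:ℝ) else 0)) ≤ r := by simpa using this
        have h3 : (∑ b, (if R (i, a) (j, b) then (1:ℝ) else 0)) / r ≤ 1 :=
          (div_le_one hrpos).2 h2
        simp only [hy]; linarith
      have e7 : ∏ j ∈ Finset.univ.erase i, y j ≤ 1 := by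
        have : ∏ j ∈ Finset.univ.erase i, y j ≤
            ∏ j ∈ Finset.univ.erase i, Real.exp (y j - 1) := by
          apply Finset.prod_le_prod
          · intro j _; exact y0 j
          · intro j _
            have := Real.add_one_le_exp (y j - 1)
            linarith
        refine this.trans ?_
        rw [← Real.exp_sum]
        have : ∑ j ∈ Finset.univ.erase i, (y j - 1) = 0 := by
          have q1 : ∑ j ∈ Finset.univ.erase i, (∑ b, (if R (i, a) (j, b) then (1:ℝ) else 0)) =
              (r:ℝ) * ((c:ℝ) - 1) / 2 := by
            rw [← hd (i, a)]
            apply Finset.sum_subset (Finset.subset_univ _)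
            intro j _ hj
            have : j = i := by simpa using hj
            subst this
            apply Finset.sum_eq_zero
            intro b _
            rw [if_neg]
            intro h
            exact hR _ _ h rfl
          have q2 : ∀ j, y j - 1 = 1/2 - (∑ b, (if R (i, a) (j, b) then (1:ℝ) else 0)) / r := by
            intro j; simp only [hy]; ring
          simp only [q2]
          rw [Finset.sum_sub_distrib, ← Finset.sum_div (f := fun j => ∑ b, (if R (i, a) (j, b) then (1:ℝ) else 0)),
            q1, Finset.sum_const, hcard, nsmul_eq_mul,
            Nat.cast_sub hc1]
          field_simp
          push_cast
          ring
        rw [this, Real.exp_zero]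
      exact mul_le_of_le_one_right (by positivity) e7
    calc _ ≤ ∑ a : Fin r, ((2 * r / 3 : ℝ)) ^ (c - 1) := Finset.sum_le_sum fun a _ => e2 a
      _ = _ := by simp
  calc _ ≤ ∑ i : Fin c, (r * (2 * r / 3) ^ (c - 1) : ℝ) := Finset.sum_le_sum fun i _ => main i
    _ = _ := by simp; ring

theorem aux_numeric (c r : ℕ) (hc : 10 ≤ c) (hr : 1 ≤ r)
    (h1r : 1 / (r : ℝ) ≥
      Real.sqrt c * (18 / 7) * (2 / (3 : ℝ) ^ ((3 : ℝ) / 4)) ^ (c - 1)) :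
    2 * ((c:ℝ) * r * (2 / 3) ^ (c - 1)) <
      Real.exp (-Real.log 3 * (((c:ℝ) - 2) / 4)) * (((c:ℝ) + 2) / 4) := by
  have hrpos : (0:ℝ) < r := by exact_mod_cast hr
  have hc' : (10:ℝ) ≤ c := by exact_mod_cast hc
  set n := c - 1 with hn
  have hnc : (n:ℝ) = c - 1 := by rw [hn, Nat.cast_sub (by omega)]; simp
  set Q : ℝ := (2 / (3 : ℝ) ^ ((3 : ℝ) / 4)) ^ n with hQ
  set E : ℝ := Real.exp (-Real.log 3 * ((n:ℝ) / 4)) with hE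
  have hEpos : 0 < E := Real.exp_pos _
  have h23 : ((2:ℝ) / 3) ^ n = Q * E := by
    have e1 : E = (Real.exp (-Real.log 3 * (1/4))) ^ n := by
      rw [← Real.exp_nat_mul, hE]; congr 1; ring
    rw [hQ, e1, ← mul_pow]
    congr 1
    rw [Real.rpow_def_of_pos (by norm_num), div_mul_eq_mul_div, div_eq_div_iff (by norm_num)
      (Real.exp_pos _).ne']
    have e2 : Real.exp (Real.log 3 * (3/4)) = 3 * Real.exp (-Real.log 3 * (1/4)) := by
      have e3 : Real.exp (Real.log 3 * (3/4)) =
          Real.exp (Real.log 3) * Real.exp (-Real.log 3 * (1/4)) := by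
        rw [← Real.exp_add]; congr 1; ring
      rw [e3, Real.exp_log (by norm_num)]
    rw [e2]; ring
  have hEE : E ≤ Real.exp (-Real.log 3 * (((c:ℝ) - 2) / 4)) := by
    apply Real.exp_le_exp.2
    have : 0 ≤ Real.log 3 := Real.log_nonneg (by norm_num)
    rw [hnc]; nlinarith
  have hk : r * (Real.sqrt c * (18 / 7) * Q) ≤ 1 := by
    have := mul_le_mul_of_nonneg_left h1r hrpos.le
    rwa [mul_one_div_cancel hrpos.ne'] at this
  have hss : Real.sqrt c * Real.sqrt c = c := Real.mul_self_sqrt (by linarith)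
  have hs : 28/9 < Real.sqrt c := by
    apply Real.lt_sqrt_of_sq_lt; norm_num; linarith
  have h5 : 2 * ((c:ℝ) * r * Q) ≤ 7/9 * Real.sqrt c := by
    have := mul_le_mul_of_nonneg_left hk (Real.sqrt_nonneg (c:ℝ))
    have e : Real.sqrt c * (r * (Real.sqrt c * (18 / 7) * Q)) = (18/7) * (c * r * Q) := by
      rw [← hss]; simp only [Real.sqrt_mul_self (Real.sqrt_nonneg _)]; ring
    rw [e] at this
    linarith
  have h6 : 7/9 * Real.sqrt c < ((c:ℝ) + 2) / 4 := by nlinarith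
  calc _ = 2 * ((c:ℝ) * r * Q) * E := by rw [h23]; ring
    _ < ((c:ℝ) + 2) / 4 * E := mul_lt_mul_of_pos_right (by linarith) hEpos
    _ ≤ _ := by rw [mul_comm]; exact mul_le_mul_of_nonneg_right hEE (by linarith)

open scoped Classical in
theorem aux_deg (c r : ℕ) (P : Fin c × Fin r → Prop) :
    ∑ j, ∑ b, (if P (j, b) then (1:ℝ) else 0) = (Nat.card {y // P y} : ℝ) := by
  rw [← Fintype.sum_prod_type' (f := fun j b => (if P (j, b) then (1:ℝ) else 0))]
  rw [Nat.card_eq_fintype_card, Fintype.card_subtype]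
  simp

/-- the transversal of a choice function -/
def auxS {c r : ℕ} (f : Fin c → Fin r) : Finset (Fin c × Fin r) :=
  Finset.univ.image (fun i => (i, f i))

theorem mem_auxS {c r : ℕ} (f : Fin c → Fin r) (x : Fin c × Fin r) :
    x ∈ auxS f ↔ x.2 = f x.1 := by
  rcases x with ⟨i, a⟩
  simp [auxS, eq_comm]

theorem auxS_transversal {c r : ℕ} (f : Fin c → Fin r) : IsTransversal (auxS f) := by
  intro i
  rw [Finset.card_eq_one]
  refine ⟨(i, f i), ?_⟩
  ext ⟨j, a⟩
  simp only [Finset.mem_filter, mem_auxS, Finset.mem_singleton, Prod.mk.injEq]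
  constructor
  · rintro ⟨h, rfl⟩; exact ⟨rfl, h⟩
  · rintro ⟨rfl, rfl⟩; exact ⟨rfl, rfl⟩

open scoped Classical in
/-- weight of a choice function -/
noncomputable def auxF {c r : ℕ} (R : Fin c × Fin r → Fin c × Fin r → Prop)
    (f : Fin c → Fin r) : ℝ :=
  ∑ i, ∏ j, (if R (i, f i) (j, f j) then (1/3:ℝ) else 1)

theorem auxF_nonneg {c r : ℕ} (R : Fin c × Fin r → Fin c × Fin r → Prop)
    (f : Fin c → Fin r) : 0 ≤ auxF R f := by
  unfold auxF
  apply Finset.sum_nonneg; intro i _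
  apply Finset.prod_nonneg; intro j _
  split_ifs <;> norm_num

theorem aux_strong {c r : ℕ} (T : MPT c r) (f : Fin c → Fin r)
    (h : auxF T.adj f + auxF (fun x y => T.adj y x) f <
      Real.exp (-Real.log 3 * (((c:ℝ) - 2) / 4)) * (((c:ℝ) + 2) / 4)) :
    T.StrongOn (auxS f) := by
  classical
  by_contra hns
  unfold MPT.StrongOn at hns
  push Not at hns
  obtain ⟨u, hu, v, hv, huv⟩ := hns
  have hasym : ∀ x y, T.adj x y → ¬ T.adj y x := by
    intro x y hxy
    have hne : x.1 ≠ y.1 := fun e => T.not_adj_same_part x y e hxy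
    exact (T.adj_iff x y hne).1 hxy
  set Rl := fun a b => a ∈ auxS f ∧ b ∈ auxS f ∧ T.adj a b with hRl
  set B : Finset (Fin c) :=
    Finset.univ.filter (fun i => Relation.ReflTransGen Rl u (i, f i)) with hB
  have hu' : (u.1, f u.1) = u := by rw [← (mem_auxS f u).1 hu]
  have hv' : (v.1, f v.1) = v := by rw [← (mem_auxS f v).1 hv]
  have huB : u.1 ∈ B := by
    simp only [hB, Finset.mem_filter, Finset.mem_univ, true_and, hu']
    exact Relation.ReflTransGen.refl
  have hvB : v.1 ∉ B := by
    simp only [hB, Finset.mem_filter, Finset.mem_univ, true_and, hv']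
    exact huv
  have hcl : ∀ i ∈ B, ∀ j, T.adj (i, f i) (j, f j) → j ∈ B := by
    intro i hi j hij
    simp only [hB, Finset.mem_filter, Finset.mem_univ, true_and] at hi ⊢
    exact hi.tail ⟨(mem_auxS f _).2 rfl, (mem_auxS f _).2 rfl, hij⟩
  have hcc : B.card + Bᶜ.card = c := by simpa using Finset.card_add_card_compl B
  have n1 := auxF_nonneg T.adj f
  have n2 := auxF_nonneg (fun x y => T.adj y x) f
  by_cases hcard : 2 * B.card ≤ c
  · have := aux_weight c (fun i j => T.adj (i, f i) (j, f j)) (fun i j => hasym _ _) B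
      ⟨_, huB⟩ hcl hcard
    unfold auxF at *
    linarith
  · have := aux_weight c (fun i j => T.adj (j, f j) (i, f i)) (fun i j => hasym _ _) Bᶜ
      ⟨v.1, by simpa using hvB⟩ (by
        intro i hi j hij
        rw [Finset.mem_compl] at hi ⊢
        exact fun hj => hi (hcl j hj i hij)) (by omega)
    unfold auxF at *
    linarith

/-- Corollary for regular tournaments: let `G_{r,c}` be a regular
balanced `c`-partite tournament with `c ≥ 10` (every vertex has out-degree and
in-degree equal to `r(c−1)/2`) satisfying
`δ(G_{r,c}) ≥ ⌊(c−2)/4⌋(r+μ) + max{δ_V⁺, δ_V⁻}`.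
If `1/r ≥ √c·(18/7)·(2/3^(3/4))^(c−1)`, then `G_{r,c}` has a strong partition. -/
theorem corollary_regular_strong_partition
    (c r : ℕ) (hc : 10 ≤ c) (hr : 1 ≤ r) (T : MPT c r)
    (hreg : ∀ x : Fin c × Fin r,
      (T.outDeg x : ℝ) = (r : ℝ) * ((c : ℝ) - 1) / 2 ∧
      (T.inDeg x : ℝ) = (r : ℝ) * ((c : ℝ) - 1) / 2)
    (hδ : T.minDeg ≥ ((c - 2) / 4) * (r + T.mu) + max T.minOutV T.minInV)
    (h1r : 1 / (r : ℝ) ≥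
      Real.sqrt c * (18 / 7) * (2 / (3 : ℝ) ^ ((3 : ℝ) / 4)) ^ (c - 1)) :
    T.HasStrongPartition := by
  classical
  have hrpos : (0:ℝ) < r := by exact_mod_cast hr
  haveI : NeZero r := ⟨by omega⟩
  have hnum := aux_numeric c r hc hr h1r
  set W := Real.exp (-Real.log 3 * (((c:ℝ) - 2) / 4)) * (((c:ℝ) + 2) / 4) with hW
  set F : (Fin c → Fin r) → ℝ := fun f => auxF T.adj f + auxF (fun x y => T.adj y x) f with hF
  have hF0 : ∀ f, 0 ≤ F f := fun f => add_nonneg (auxF_nonneg _ _) (auxF_nonneg _ _)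
  have hav : ∑ f, F f ≤ 2 * ((c:ℝ) * r * (2 * r / 3) ^ (c - 1)) := by
    have a1 := aux_average c r hr T.adj
      (fun x y h e => T.not_adj_same_part x y e h)
      (fun x => by rw [aux_deg c r (fun y => T.adj x y)]; exact (hreg x).1)
    have a2 := aux_average c r hr (fun x y => T.adj y x)
      (fun x y h e => T.not_adj_same_part y x e.symm h)
      (fun x => by rw [aux_deg c r (fun y => T.adj y x)]; exact (hreg x).2)
    simp only [hF, Finset.sum_add_distrib]
    unfold auxF
    linarith
  have hex : ∃ t : Fin c → Fin r, ∑ k : Fin r, F (fun i => t i + k) < W := by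
    by_contra hno
    push Not at hno
    have b1 : ∑ t : Fin c → Fin r, W ≤ ∑ t : Fin c → Fin r, ∑ k : Fin r, F (fun i => t i + k) :=
      Finset.sum_le_sum fun t _ => hno t
    rw [Finset.sum_comm] at b1
    have b2 : ∀ k : Fin r, ∑ t : Fin c → Fin r, F (fun i => t i + k) = ∑ f, F f := by
      intro k
      exact Equiv.sum_comp (Equiv.addRight (fun _ : Fin c => k)) F
    simp only [b2] at b1
    simp only [Finset.sum_const, Finset.card_univ, Fintype.card_pi, Fintype.card_fin,
      Finset.prod_const, nsmul_eq_mul] at b1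
    push_cast at b1
    have b3 : (r:ℝ) ^ c * (2 * ((c:ℝ) * r * (2 / 3) ^ (c - 1))) < (r:ℝ) ^ c * W :=
      mul_lt_mul_of_pos_left hnum (by positivity)
    have b4 : (r:ℝ) * ∑ f, F f ≤ r * (2 * ((c:ℝ) * r * (2 * r / 3) ^ (c - 1))) :=
      mul_le_mul_of_nonneg_left hav hrpos.le
    have b5 : (r:ℝ) * (2 * ((c:ℝ) * r * (2 * r / 3) ^ (c - 1))) =
        (r:ℝ) ^ c * (2 * ((c:ℝ) * r * (2 / 3) ^ (c - 1))) := by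
      obtain ⟨n, rfl⟩ : ∃ n, c = n + 1 := ⟨c - 1, by omega⟩
      simp only [Nat.add_sub_cancel]
      rw [show (2 * (r:ℝ) / 3) = r * (2/3) by ring, mul_pow]
      ring
    linarith
  obtain ⟨t, ht⟩ := hex
  have hk : ∀ k : Fin r, F (fun i => t i + k) < W := by
    intro k
    refine lt_of_le_of_lt ?_ ht
    exact Finset.single_le_sum (f := fun k : Fin r => F (fun i => t i + k))
      (fun k _ => hF0 _) (Finset.mem_univ k)
  refine ⟨Finset.univ.image (fun k : Fin r => auxS (fun i => t i + k)), ⟨?_, ?_, ?_⟩, ?_⟩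
  · intro S hS
    obtain ⟨k, _, rfl⟩ := Finset.mem_image.1 hS
    exact auxS_transversal _
  · intro S hS S' hS' hne
    obtain ⟨k, _, rfl⟩ := Finset.mem_image.1 hS
    obtain ⟨k', _, rfl⟩ := Finset.mem_image.1 hS'
    rw [Finset.disjoint_left]
    intro x hx hx'
    rw [mem_auxS] at hx hx'
    apply hne
    have : k = k' := add_left_cancel (hx.symm.trans hx')
    rw [this]
  · intro v
    refine ⟨_, Finset.mem_image_of_mem _ (Finset.mem_univ (v.2 - t v.1)), ?_⟩
    rw [mem_auxS]
    simp
  · intro S hS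
    obtain ⟨k, _, rfl⟩ := Finset.mem_image.1 hS
    exact aux_strong T _ (hk k)
end

section
/- Let r > 0 be a real number, let c ≥ 4 be an integer, and let g_1, g_2, …, g_{c−1} be real numbers with 0 ≤ g_i ≤ r for all i, such that g_{c−1} = Γ := max_i g_i and g_{c−2} = γ := min_i g_i. Let p_r = |{i ∈ {1,…,c−3} : g_i = r}|, and let q be an integer with q ≥ p_r + 1. If Σ_{i=1}^{c−1} g_i ≥ q(r + Γ − γ) + γ, then Σ_{k=0}^{q} M(g_1,…,g_{c−1}; k) ≤ Σ_{k=0}^{q} C(c−1, k) · ε^k · (r − ε)^(c−1−k), where ε = (Σ_{i=1}^{c−1} g_i)/(c−1). -/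
open Finset

/-- `M(g₁,…,g_s; k) = Σ_{I ⊆ {1,…,s}, |I| = k} (Π_{i∈I} g_i)·(Π_{i∉I} (r − g_i))`. -/
noncomputable def Mfun {s : ℕ} (r : ℝ) (g : Fin s → ℝ) (k : ℕ) : ℝ :=
  ∑ I ∈ Finset.powersetCard k (Finset.univ : Finset (Fin s)),
    (∏ i ∈ I, g i) * ∏ i ∈ Iᶜ, (r - g i)

noncomputable def WW {n : ℕ} (r : ℝ) (s : Finset (Fin n)) (g : Fin n → ℝ) (k : ℕ) : ℝ :=
  ∑ I ∈ Finset.powersetCard k s, (∏ i ∈ I, g i) * ∏ i ∈ s \ I, (r - g i)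

noncomputable def TT {n : ℕ} (r : ℝ) (s : Finset (Fin n)) (g : Fin n → ℝ) (m : ℕ) : ℝ :=
  ∑ k ∈ Finset.range m, WW r s g k

lemma WW_congr {n : ℕ} (r : ℝ) (s : Finset (Fin n)) (g h : Fin n → ℝ)
    (hh : ∀ i ∈ s, g i = h i) (k : ℕ) : WW r s g k = WW r s h k := by
  unfold WW
  apply Finset.sum_congr rfl
  intro I hI
  rw [Finset.mem_powersetCard] at hI
  congr 1
  · exact Finset.prod_congr rfl fun i hi => hh i (hI.1 hi)
  · refine Finset.prod_congr rfl fun i hi => ?_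
    rw [hh i (Finset.mem_sdiff.1 hi).1]

lemma TT_congr {n : ℕ} (r : ℝ) (s : Finset (Fin n)) (g h : Fin n → ℝ)
    (hh : ∀ i ∈ s, g i = h i) (k : ℕ) : TT r s g k = TT r s h k :=
  Finset.sum_congr rfl fun _ _ => WW_congr r s g h hh _

lemma WW_zero {n : ℕ} (r : ℝ) (s : Finset (Fin n)) (g : Fin n → ℝ) (a : Fin n) (ha : a ∉ s) :
    WW r (insert a s) g 0 = (r - g a) * WW r s g 0 := by
  simp [WW, Finset.prod_insert ha]

lemma WW_succ {n : ℕ} (r : ℝ) (s : Finset (Fin n)) (g : Fin n → ℝ) (a : Fin n) (ha : a ∉ s)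
    (k : ℕ) :
    WW r (insert a s) g (k+1) = (r - g a) * WW r s g (k+1) + g a * WW r s g k := by
  unfold WW
  rw [Finset.powersetCard_succ_insert ha, Finset.sum_union, Finset.sum_image]
  · rw [Finset.mul_sum, Finset.mul_sum]
    congr 1
    · apply Finset.sum_congr rfl
      intro I hI
      rw [Finset.mem_powersetCard] at hI
      have haI : a ∉ I := fun h => ha (hI.1 h)
      rw [Finset.insert_sdiff_of_notMem _ haI, Finset.prod_insert (by simp [ha])]
      ring
    · apply Finset.sum_congr rfl
      intro I hI
      rw [Finset.mem_powersetCard] at hI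
      have haI : a ∉ I := fun h => ha (hI.1 h)
      have : insert a s \ insert a I = s \ I := by
        ext x
        simp only [Finset.mem_sdiff, Finset.mem_insert]
        constructor
        · tauto
        · rintro ⟨h1, h2⟩
          refine ⟨Or.inr h1, ?_⟩
          rintro (rfl | h)
          · exact ha h1
          · exact h2 h
      rw [this, Finset.prod_insert haI]
      ring
  · intro I hI J hJ h
    simp only [Finset.mem_coe,
      Finset.mem_powersetCard] at hI hJ
    have h1 : a ∉ I := fun h => ha (hI.1 h)
    have h2 : a ∉ J := fun h => ha (hJ.1 h)
    rw [← Finset.erase_insert h1, ← Finset.erase_insert h2]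
    exact congrArg (fun s => Finset.erase s a) h
  · rw [Finset.disjoint_left]
    intro I hI hJ
    rw [Finset.mem_powersetCard] at hI
    rw [Finset.mem_image] at hJ
    obtain ⟨J, _, rfl⟩ := hJ
    exact ha (hI.1 (Finset.mem_insert_self _ _))

lemma TT_succ {n : ℕ} (r : ℝ) (s : Finset (Fin n)) (g : Fin n → ℝ) (a : Fin n) (ha : a ∉ s)
    (m : ℕ) :
    TT r (insert a s) g (m+1) = (r - g a) * TT r s g (m+1) + g a * TT r s g m := by
  induction m with
  | zero => simp [TT, WW_zero r s g a ha]
  | succ m ih =>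
    have e : ∀ u k, TT r u g (k+1) = TT r u g k + WW r u g k := fun u k => by
      simp [TT, Finset.sum_range_succ]
    rw [e (insert a s) (m+1), ih, WW_succ r s g a ha, e s (m+1), e s m]
    ring

lemma double_count {n : ℕ} (r : ℝ) (s : Finset (Fin n)) (g : Fin n → ℝ) (m : ℕ) :
    ((m:ℝ)+1) * WW r s g (m+1) =
      ∑ J ∈ Finset.powersetCard m s, ∑ i ∈ s \ J,
        g i * ((∏ j ∈ J, g j) * ∏ j ∈ (s \ J).erase i, (r - g j)) := by
  have h1 : ((m:ℝ)+1) * WW r s g (m+1) = ∑ I ∈ Finset.powersetCard (m+1) s, ∑ i ∈ I,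
      (∏ i ∈ I, g i) * ∏ i ∈ s \ I, (r - g i) := by
    unfold WW
    rw [Finset.mul_sum]
    apply Finset.sum_congr rfl
    intro I hI
    rw [Finset.mem_powersetCard] at hI
    rw [Finset.sum_const, hI.2, nsmul_eq_mul]
    push_cast
    ring
  rw [h1, Finset.sum_sigma', Finset.sum_sigma']
  refine Finset.sum_bij' (fun x _ => ⟨x.1.erase x.2, x.2⟩) (fun x _ => ⟨insert x.2 x.1, x.2⟩)
    ?_ ?_ ?_ ?_ ?_
  · rintro ⟨I, i⟩ h
    simp only [Finset.mem_sigma, Finset.mem_powersetCard, Finset.mem_sdiff] at h ⊢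
    refine ⟨⟨(Finset.erase_subset _ _).trans h.1.1, ?_⟩, h.1.1 h.2, by simp⟩
    rw [Finset.card_erase_of_mem h.2, h.1.2]; rfl
  · rintro ⟨I, i⟩ h
    simp only [Finset.mem_sigma, Finset.mem_powersetCard, Finset.mem_sdiff] at h ⊢
    refine ⟨⟨Finset.insert_subset h.2.1 h.1.1, ?_⟩, by simp⟩
    rw [Finset.card_insert_of_notMem h.2.2, h.1.2]
  · rintro ⟨I, i⟩ h
    simp only [Finset.mem_sigma] at h
    simp [Finset.insert_erase h.2]
  · rintro ⟨I, i⟩ h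
    simp only [Finset.mem_sigma, Finset.mem_sdiff] at h
    simp [Finset.erase_insert h.2.2]
  · rintro ⟨I, i⟩ h
    simp only [Finset.mem_sigma, Finset.mem_powersetCard] at h
    have : (s \ I.erase i).erase i = s \ I := by
      ext x
      simp only [Finset.mem_sdiff, Finset.mem_erase]
      constructor
      · tauto
      · rintro ⟨h1, h2⟩
        refine ⟨?_, h1, fun h => h2 h.2⟩
        rintro rfl
        exact h2 h.2
    simp only [this]
    rw [← Finset.mul_prod_erase I g h.2]
    ring

lemma WW_mono {n : ℕ} (r : ℝ) (s : Finset (Fin n)) (g : Fin n → ℝ) (m : ℕ) (G y : ℝ)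
    (hg : ∀ i, 0 ≤ g i ∧ g i ≤ r) (hG : ∀ i, g i ≤ G) (hy : ∀ i, y ≤ g i) (hyr : y < r)
    (hs : ∑ i ∈ s, g i ≥ ((m:ℝ)+1) * (r + G - y) - G) :
    WW r s g m ≤ WW r s g (m+1) := by
  have key : ((m:ℝ)+1) * (r - y) * WW r s g m ≤ (r - y) * (((m:ℝ)+1) * WW r s g (m+1)) := by
    rw [double_count, WW, Finset.mul_sum, Finset.mul_sum]
    apply Finset.sum_le_sum
    intro J hJ
    rw [Finset.mem_powersetCard] at hJ
    set w := (∏ i ∈ J, g i) * ∏ i ∈ s \ J, (r - g i) with hw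
    have hp : 0 ≤ ∏ i ∈ J, g i := Finset.prod_nonneg fun i _ => (hg i).1
    have hw0 : 0 ≤ w := mul_nonneg hp (Finset.prod_nonneg fun i _ => sub_nonneg.2 (hg i).2)
    have hsum : ((m:ℝ)+1) * (r - y) ≤ ∑ i ∈ s \ J, g i := by
      have h1 := Finset.sum_sdiff (f := g) hJ.1
      have h2 : ∑ i ∈ J, g i ≤ m * G := by
        have := Finset.sum_le_card_nsmul J g G (fun i _ => hG i)
        rwa [hJ.2, nsmul_eq_mul] at this
      linarith
    calc ((m:ℝ)+1) * (r - y) * w ≤ (∑ i ∈ s \ J, g i) * w := mul_le_mul_of_nonneg_right hsum hw0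
      _ = ∑ i ∈ s \ J, g i * w := Finset.sum_mul _ _ _
      _ ≤ _ := by
        rw [Finset.mul_sum]
        apply Finset.sum_le_sum
        intro i hi
        have hE : 0 ≤ ∏ j ∈ (s \ J).erase i, (r - g j) :=
          Finset.prod_nonneg fun i _ => sub_nonneg.2 (hg i).2
        rw [hw, ← Finset.mul_prod_erase (s \ J) (fun j => r - g j) hi]
        have := mul_le_mul_of_nonneg_right (sub_le_sub_left (hy i) r)
          (mul_nonneg (hg i).1 (mul_nonneg hp hE))
        linarith
  have hpos : 0 < ((m:ℝ)+1) * (r - y) := mul_pos (by positivity) (by linarith)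
  refine le_of_mul_le_mul_left ?_ hpos
  linarith

lemma TT_pair {n : ℕ} (r : ℝ) (s : Finset (Fin n)) (g : Fin n → ℝ) (a b : Fin n)
    (hb : b ∉ s) (ha : a ∉ insert b s) (m : ℕ) :
    TT r (insert a (insert b s)) g (m+2) =
      r^2 * TT r s g (m+2) - r * (g a + g b) * (TT r s g (m+2) - TT r s g (m+1)) +
      g a * g b * (WW r s g (m+1) - WW r s g m) := by
  have e : ∀ k, TT r s g (k+1) = TT r s g k + WW r s g k := fun k => by
    simp [TT, Finset.sum_range_succ]
  rw [TT_succ r _ g a ha (m+1), TT_succ r s g b hb, TT_succ r s g b hb, e (m+1), e m]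
  ring

lemma main_ind {n : ℕ} (r : ℝ) (m : ℕ) (S e : ℝ) (hSe : S = n * e) :
    ∀ (N : ℕ) (g : Fin n → ℝ) (G y : ℝ), #{i | g i ≠ e} ≤ N →
    (∀ i, 0 ≤ g i ∧ g i ≤ r) → (∀ i, g i ≤ G) → (∀ i, y ≤ g i) → ∑ i, g i = S →
    S ≥ ((m:ℝ)+1) * (r + G - y) + y →
    TT r univ g (m+2) ≤ TT r univ (fun _ : Fin n => e) (m+2) := by
  intro N
  induction N with
  | zero =>
    intro g G y hN _ _ _ _ _
    apply le_of_eq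
    apply TT_congr
    intro i _
    by_contra h
    have : i ∈ ({i | g i ≠ e} : Finset (Fin n)) := by simp [h]
    rw [Finset.card_eq_zero.1 (Nat.le_zero.1 hN)] at this
    simp at this
  | succ N ih =>
    intro g G y hN hg hG hy hS hc
    by_cases hall : ∀ i, g i = e
    · exact le_of_eq (TT_congr _ _ _ _ (fun i _ => hall i) _)
    push Not at hall
    obtain ⟨i0, hi0⟩ := hall
    have hne : (univ : Finset (Fin n)).Nonempty := ⟨i0, mem_univ _⟩
    obtain ⟨a, -, ha⟩ := Finset.exists_max_image univ g hne
    obtain ⟨b, -, hb⟩ := Finset.exists_min_image univ g hne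
    have hsum0 : ∑ i, g i = ∑ i : Fin n, e := by simp [hS, hSe]
    have hae : e < g a := by
      by_contra h
      push Not at h
      have h1 : ∀ i ∈ univ, g i ≤ e := fun i hi => (ha i hi).trans h
      exact hi0 ((Finset.sum_eq_sum_iff_of_le h1).1 hsum0 i0 (mem_univ _))
    have hbe : g b < e := by
      by_contra h
      push Not at h
      have h1 : ∀ i ∈ univ, e ≤ g i := fun i hi => h.trans (hb i hi)
      exact hi0 ((Finset.sum_eq_sum_iff_of_le h1).1 hsum0.symm i0 (mem_univ _)).symm
    have hab : a ≠ b := by rintro rfl; linarith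
    have hc' : S ≥ ((m:ℝ)+1) * (r + g a - g b) + g b := by
      have h1 := hG a
      have h2 := hy b
      have hm : (0:ℝ) ≤ m := Nat.cast_nonneg m
      nlinarith [mul_nonneg hm (sub_nonneg.2 h1), mul_nonneg hm (sub_nonneg.2 h2)]
    set s : Finset (Fin n) := (univ.erase a).erase b with hs
    have hbs : b ∉ s := by simp [hs]
    have hins : insert b s = univ.erase a := Finset.insert_erase (by simp [hab.symm])
    have has : a ∉ insert b s := by simp [hins]
    have huniv : insert a (insert b s) = univ := by
      rw [hins]; exact Finset.insert_erase (mem_univ _)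
    set g' : Fin n → ℝ := fun i => if i = a then e else if i = b then g a + g b - e else g i with hg'
    have ga : g' a = e := by simp [hg']
    have gb : g' b = g a + g b - e := by simp [hg', hab.symm]
    have go : ∀ i, i ≠ a → i ≠ b → g' i = g i := fun i h1 h2 => by simp [hg', h1, h2]
    have gs : ∀ i ∈ s, g' i = g i := fun i hi => by
      simp only [hs, mem_erase] at hi
      exact go i hi.2.1 hi.1
    have hub : ∀ i, g' i ≤ g a := by
      intro i
      by_cases h1 : i = a
      · rw [h1, ga]; exact hae.le
      by_cases h2 : i = b
      · rw [h2, gb]; linarith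
      rw [go i h1 h2]; exact ha i (mem_univ _)
    have hlb : ∀ i, g b ≤ g' i := by
      intro i
      by_cases h1 : i = a
      · rw [h1, ga]; exact hbe.le
      by_cases h2 : i = b
      · rw [h2, gb]; linarith
      rw [go i h1 h2]; exact hb i (mem_univ _)
    have dec : ∀ f : Fin n → ℝ, ∑ i, f i = f a + (f b + ∑ i ∈ s, f i) := fun f => by
      rw [← huniv, Finset.sum_insert has, Finset.sum_insert hbs]
    have hgsum := dec g
    have hS' : ∑ i, g' i = S := by
      rw [dec g', ga, gb, Finset.sum_congr rfl gs]
      linarith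
    have hcard : #{i | g' i ≠ e} ≤ N := by
      have : ({i | g' i ≠ e} : Finset (Fin n)) ⊂ ({i | g i ≠ e} : Finset (Fin n)) := by
        rw [Finset.ssubset_iff_of_subset]
        · exact ⟨a, by simp [hae.ne'], by simp [ga]⟩
        · intro i hi
          simp only [mem_filter, mem_univ, true_and] at hi ⊢
          by_cases h1 : i = a
          · rw [h1]; exact hae.ne'
          by_cases h2 : i = b
          · rw [h2]; exact hbe.ne
          rwa [go i h1 h2] at hi
      have := Finset.card_lt_card this
      omega
    refine le_trans ?_ (ih g' (g a) (g b) hcard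
      (fun i => ⟨(hg b).1.trans (hlb i), (hub i).trans (hg a).2⟩) hub hlb hS' hc')
    have hmono : WW r s g m ≤ WW r s g (m+1) := by
      refine WW_mono r s g m (g a) (g b) hg (fun i => ha i (mem_univ _))
        (fun i => hb i (mem_univ _)) (by linarith [(hg a).2]) ?_
      linarith
    rw [← huniv, TT_pair r s g a b hbs has, TT_pair r s g' a b hbs has,
      TT_congr r s g' g gs, TT_congr r s g' g gs, WW_congr r s g' g gs, WW_congr r s g' g gs,
      ga, gb]
    have h1 : 0 ≤ (g a - e) * (e - g b) := mul_nonneg (by linarith) (by linarith)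
    have h2 := mul_nonneg h1 (sub_nonneg.2 hmono)
    nlinarith

/-- Proposition: let `0 < r`, `c ≥ 4` and `g₁,…,g_{c−1} ∈ [0,r]`
with `g_{c−1} = Γ` the maximum and `g_{c−2} = γ` the minimum, let
`p_r = |{i ∈ {1,…,c−3} : g_i = r}|` and `q ≥ p_r + 1`.  If
`Σ g_i ≥ q(r + Γ − γ) + γ`, then
`Σ_{k=0}^{q} M(g;k) ≤ Σ_{k=0}^{q} C(c−1,k) ε^k (r−ε)^(c−1−k)` with
`ε = (Σ g_i)/(c−1)`.  (Indices are shifted: `g_j` of the paper is `g ⟨j−1⟩`.) -/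
theorem proposition_M_le_binomial
    (r : ℝ) (hr : 0 < r) (c : ℕ) (hc : 4 ≤ c)
    (g : Fin (c - 1) → ℝ) (hg : ∀ i, 0 ≤ g i ∧ g i ≤ r)
    (hmax : ∀ i, g i ≤ g ⟨c - 2, by omega⟩)
    (hmin : ∀ i, g ⟨c - 3, by omega⟩ ≤ g i)
    (q : ℕ)
    (hq : Nat.card {i : Fin (c - 1) // (i : ℕ) < c - 3 ∧ g i = r} + 1 ≤ q)
    (hsum : ∑ i, g i ≥
      (q : ℝ) * (r + g ⟨c - 2, by omega⟩ - g ⟨c - 3, by omega⟩) +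
        g ⟨c - 3, by omega⟩) :
    ∑ k ∈ Finset.range (q + 1), Mfun r g k ≤
      ∑ k ∈ Finset.range (q + 1),
        ((c - 1).choose k : ℝ) * ((∑ i, g i) / ((c : ℝ) - 1)) ^ k *
          (r - (∑ i, g i) / ((c : ℝ) - 1)) ^ (c - 1 - k) := by
  obtain ⟨m, rfl⟩ : ∃ m, q = m + 1 := ⟨q - 1, by omega⟩
  have hn : ((c - 1 : ℕ) : ℝ) = (c : ℝ) - 1 := by
    rw [Nat.cast_sub (by omega)]; simp
  have hn0 : (c : ℝ) - 1 ≠ 0 := by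
    have : (4 : ℝ) ≤ c := by exact_mod_cast hc
    linarith
  have h := main_ind r m (∑ i, g i) ((∑ i, g i) / ((c : ℝ) - 1))
    (by rw [hn]; field_simp) _ g _ _ le_rfl hg hmax hmin rfl (by push_cast at hsum; exact hsum)
  have h1 : TT r univ g (m+2) = ∑ k ∈ Finset.range (m + 1 + 1), Mfun r g k := by
    simp only [TT, WW, Mfun, Finset.compl_eq_univ_sdiff]
  rw [← h1]
  refine h.trans (le_of_eq ?_)
  unfold TT WW
  apply Finset.sum_congr rfl
  intro k _
  rw [Finset.sum_congr rfl (g := fun _ => ((∑ i, g i) / ((c : ℝ) - 1)) ^ k *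
          (r - (∑ i, g i) / ((c : ℝ) - 1)) ^ (c - 1 - k))]
  · simp [mul_assoc]
  · intro I hI
    rw [Finset.mem_powersetCard] at hI
    rw [Finset.prod_const, Finset.prod_const, Finset.card_sdiff_of_subset hI.1, hI.2]
    simp
end

section
/- Let r > 0 be a real number, let c ≥ 4 be an integer, let q be a positive integer, and let g_1,…,g_{c−1} be real numbers with 0 ≤ g_i ≤ r such that g_{c−1} = Γ := max_i g_i, g_{c−2} = γ := min_i g_i, and for nonnegative integers t, p_r, p_0 with t + p_r + p_0 = c−3: 0 < g_i < r for 1 ≤ i ≤ t, g_i = r for t+1 ≤ i ≤ t+p_r, and g_i = 0 for t+p_r+1 ≤ i ≤ c−3. Assume q ≥ p_r + 1 and Σ_{i=1}^{c−1} g_i ≥ q(r + Γ − γ) + γ. Then for every subset I ⊆ {1,…,t} with |I| = t − (q − p_r) + 1, one has Σ_{i∈I} g_i/(r − g_i) ≥ q − p_r. -/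
open Finset

/-- Claim 1: with `0 < r`, `c ≥ 4`, `q ≥ 1`, `g₁,…,g_{c−1} ∈ [0,r]`,
`g_{c−1} = Γ` the maximum, `g_{c−2} = γ` the minimum, `t + p_r + p_0 = c − 3`,
`0 < g_i < r` for `i ≤ t`, `g_i = r` for `t+1 ≤ i ≤ t+p_r`, `g_i = 0` for
`t+p_r+1 ≤ i ≤ c−3`, `q ≥ p_r + 1` and `Σ g_i ≥ q(r + Γ − γ) + γ`: every
`I ⊆ {1,…,t}` with `|I| = t − (q − p_r) + 1` satisfies
`Σ_{i∈I} g_i/(r − g_i) ≥ q − p_r`.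
(Indices are shifted: `g_j` of the paper is `g ⟨j−1⟩`.) -/
theorem claim_sum_ratio_ge
    (r : ℝ) (hr : 0 < r) (c : ℕ) (hc : 4 ≤ c) (q : ℕ) (hq0 : 0 < q)
    (g : Fin (c - 1) → ℝ) (hg : ∀ i, 0 ≤ g i ∧ g i ≤ r)
    (hmax : ∀ i, g i ≤ g ⟨c - 2, by omega⟩)
    (hmin : ∀ i, g ⟨c - 3, by omega⟩ ≤ g i)
    (t pr p0 : ℕ) (htp : t + pr + p0 = c - 3)
    (h1 : ∀ i : Fin (c - 1), (i : ℕ) < t → 0 < g i ∧ g i < r)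
    (h2 : ∀ i : Fin (c - 1), t ≤ (i : ℕ) → (i : ℕ) < t + pr → g i = r)
    (h3 : ∀ i : Fin (c - 1), t + pr ≤ (i : ℕ) → (i : ℕ) < c - 3 → g i = 0)
    (hq : pr + 1 ≤ q)
    (hsum : ∑ i, g i ≥
      (q : ℝ) * (r + g ⟨c - 2, by omega⟩ - g ⟨c - 3, by omega⟩) +
        g ⟨c - 3, by omega⟩)
    (I : Finset (Fin (c - 1))) (hI : ∀ i ∈ I, (i : ℕ) < t)
    (hIcard : I.card = t - (q - pr) + 1) :
    ∑ i ∈ I, g i / (r - g i) ≥ (q : ℝ) - (pr : ℝ) := by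
  have hUcard : (univ.filter (fun i : Fin (c-1) => (i:ℕ) < t)).card = t := by
    rw [Fin.card_filter_val_lt]; omega
  set U := univ.filter (fun i : Fin (c-1) => (i:ℕ) < t) with hU
  set Γ := g ⟨c - 2, by omega⟩ with hΓ
  set γ := g ⟨c - 3, by omega⟩ with hγ
  have hrest : ∑ i ∈ univ.filter (fun i : Fin (c-1) => ¬ (i:ℕ) < t), g i = pr * r + γ + Γ := by
    rw [Finset.sum_filter]
    let H : ℕ → ℝ := fun n => if n < t then 0 else if h : n < c - 1 then g ⟨n, h⟩ else 0
    have e1 : ∑ i : Fin (c-1), (if ¬ (i:ℕ) < t then g i else 0) = ∑ n ∈ range (c-1), H n := by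
      rw [Finset.sum_range]
      refine Finset.sum_congr rfl fun i _ => ?_
      by_cases h : (i:ℕ) < t <;> simp [H, h]
    have e2 : c - 1 = t + pr + p0 + 1 + 1 := by omega
    rw [e1, e2, Finset.sum_range_succ, Finset.sum_range_succ, Finset.sum_range_add,
      Finset.sum_range_add]
    have a1 : ∑ n ∈ range t, H n = 0 := Finset.sum_eq_zero fun n hn => by
      simp [H, Finset.mem_range.1 hn]
    have a2 : ∑ n ∈ range pr, H (t + n) = pr * r := by
      rw [Finset.sum_congr rfl (g := fun _ => r)]
      · simp
      · intro n hn
        have := Finset.mem_range.1 hn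
        have h' : t + n < c - 1 := by omega
        simp only [H, h', dif_pos]
        rw [if_neg (by omega)]
        exact h2 _ (by simp) (by simpa using this)
    have a3 : ∑ n ∈ range p0, H (t + pr + n) = 0 := Finset.sum_eq_zero fun n hn => by
      have := Finset.mem_range.1 hn
      have h' : t + pr + n < c - 1 := by omega
      simp only [H, h', dif_pos]
      rw [if_neg (by omega)]
      exact h3 _ (by simp) (by simp only []; omega)
    have a4 : H (t + pr + p0) = γ := by
      have h' : t + pr + p0 < c - 1 := by omega
      simp only [H, h', dif_pos]
      rw [if_neg (by omega), hγ]
      congr 2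
    have a5 : H (t + pr + p0 + 1) = Γ := by
      have h' : t + pr + p0 + 1 < c - 1 := by omega
      simp only [H, h', dif_pos]
      rw [if_neg (by omega), hΓ]
      congr 2; omega
    rw [a1, a2, a3, a4, a5]; ring
  rw [← Finset.sum_filter_add_sum_filter_not univ (fun i : Fin (c-1) => (i:ℕ) < t), hrest,
    ← hU] at hsum
  have hIne : I.Nonempty := Finset.card_pos.1 (by omega)
  have hIU : I ⊆ U := fun i hi => by simp [hU, hI i hi]
  obtain ⟨i0, hi0⟩ := hIne
  have hγr : γ < r := (hmin i0).trans_lt (h1 i0 (hI i0 hi0)).2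
  have hγΓ : γ ≤ Γ := hmin _
  obtain ⟨s, rfl⟩ := Nat.exists_eq_add_of_le (show pr ≤ q by omega)
  have hs1 : 1 ≤ s := by omega
  have hs1' : (1:ℝ) ≤ s := by exact_mod_cast hs1
  have hpr : (0:ℝ) ≤ pr := Nat.cast_nonneg _
  push_cast at hsum
  have hprm : 0 ≤ (pr:ℝ) * (Γ - γ) := mul_nonneg hpr (by linarith)
  have hst : s ≤ t := by
    by_contra hcon
    have hlt : ∑ i ∈ U, g i < ∑ i ∈ U, r := by
      refine Finset.sum_lt_sum (fun i _ => (hg i).2) ⟨i0, hIU hi0, (h1 i0 (hI i0 hi0)).2⟩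
    rw [Finset.sum_const, hUcard, nsmul_eq_mul] at hlt
    have : (t:ℝ) + 1 ≤ s := by exact_mod_cast (by omega : t + 1 ≤ s)
    nlinarith [mul_nonneg (sub_nonneg.2 hs1') (sub_nonneg.2 hγΓ), mul_nonneg (sub_nonneg.2 this) hr.le]
  have hJ : ∑ i ∈ U \ I, g i ≤ (s - 1) * Γ := by
    have := Finset.sum_le_card_nsmul (U \ I) g Γ (fun i _ => hmax i)
    have hc' : (U \ I).card = s - 1 := by
      rw [Finset.card_sdiff_of_subset hIU, hUcard, hIcard]; omega
    rw [hc', nsmul_eq_mul, Nat.cast_sub hs1] at this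
    simpa using this
  have hsplit := Finset.sum_sdiff (f := g) hIU
  have hS : (s:ℝ) * (r - γ) ≤ ∑ i ∈ I, g i := by nlinarith
  have hle : (∑ i ∈ I, g i) / (r - γ) ≤ ∑ i ∈ I, g i / (r - g i) := by
    rw [Finset.sum_div]
    refine Finset.sum_le_sum fun i hi => ?_
    have := (h1 i (hI i hi)).2
    exact div_le_div_of_nonneg_left (hg i).1 (by linarith) (by linarith [hmin i])
  have : (s:ℝ) ≤ (∑ i ∈ I, g i) / (r - γ) := by
    rw [le_div_iff₀ (by linarith)]; exact hS
  push_cast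
  linarith
end

section
/- Let r > 0 be a real number, let c ≥ 4 be an integer, let q be a positive integer, and let g_1,…,g_{c−1} be real numbers with 0 ≤ g_i ≤ r such that g_{c−1} = Γ := max_i g_i and g_{c−2} = γ := min_i g_i. Let p_r = |{i ∈ {1,…,c−3} : g_i = r}| and assume q ≥ p_r + 1 and Σ_{i=1}^{c−1} g_i ≥ q(r + Γ − γ) + γ. Define g'_i = g_i for 1 ≤ i ≤ c−3 and g'_{c−2} = g'_{c−1} = (g_{c−2} + g_{c−1})/2. Then Σ_{k=0}^{q} M(g_1,…,g_{c−1}; k) ≤ Σ_{k=0}^{q} M(g'_1,…,g'_{c−1}; k). -/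
open Finset

open Polynomial in
noncomputable def genP {n : ℕ} (r : ℝ) (g : Fin n → ℝ) : Polynomial ℝ :=
  ∏ i, (C (g i) * X + C (r - g i))

open Polynomial in
lemma Mfun_eq_coeff {n : ℕ} (r : ℝ) (g : Fin n → ℝ) (k : ℕ) :
    Mfun r g k = (genP r g).coeff k := by
  classical
  unfold Mfun genP
  rw [Finset.prod_add, Polynomial.finsetSum_coeff]
  have h : ∀ t ∈ (univ : Finset (Fin n)).powerset,
      ((∏ i ∈ t, (C (g i) * X)) * ∏ i ∈ univ \ t, C (r - g i)).coeff k =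
      if t.card = k then (∏ i ∈ t, g i) * ∏ i ∈ tᶜ, (r - g i) else 0 := by
    intro t _
    rw [Finset.prod_mul_distrib, Finset.prod_const, ← map_prod, ← map_prod,
      Polynomial.coeff_mul_C, Polynomial.coeff_C_mul, Polynomial.coeff_X_pow,
      ← Finset.compl_eq_univ_sdiff]
    by_cases h : t.card = k
    · simp [h]
    · simp [h, Ne.symm h]
  rw [Finset.sum_congr rfl h, ← Finset.sum_filter, Finset.powersetCard_eq_filter]

open Polynomial in
lemma coeff_nonneg_prod {n : ℕ} (r : ℝ) (g : Fin n → ℝ) (hg : ∀ i, 0 ≤ g i ∧ g i ≤ r)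
    (s : Finset (Fin n)) : ∀ k,
    0 ≤ (∏ i ∈ s, (C (g i) * X + C (r - g i))).coeff k := by
  classical
  induction s using Finset.induction_on with
  | empty =>
    intro k
    rw [Finset.prod_empty, Polynomial.coeff_one]
    split_ifs <;> norm_num
  | insert a s ha ih =>
    intro k
    rw [Finset.prod_insert ha, add_mul, Polynomial.coeff_add, Polynomial.coeff_C_mul, mul_assoc,
      Polynomial.coeff_C_mul]
    have h1 := hg a
    have h2 : 0 ≤ (X * ∏ i ∈ s, (C (g i) * X + C (r - g i))).coeff k := by
      cases k with
      | zero => simp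
      | succ k => rw [Polynomial.coeff_X_mul]; exact ih k
    have := mul_nonneg h1.1 h2
    have := mul_nonneg (sub_nonneg.2 h1.2) (ih k)
    linarith

open Polynomial in
lemma key {n : ℕ} (r : ℝ) (h : Fin n → ℝ) (hh : ∀ i, 0 ≤ h i ∧ h i ≤ r) (m : ℕ)
    (a b : ℝ) (hb : ∀ i, b ≤ h i) (ha : ∀ i, h i ≤ a) (hbr : b < r)
    (hs : ((m : ℝ) + 1) * (r + a - b) - a ≤ ∑ i, h i) :
    (genP r h).coeff m ≤ (genP r h).coeff (m + 1) := by
  classical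
  set Q : Fin n → Polynomial ℝ := fun i => ∏ j ∈ univ.erase i, (C (h j) * X + C (r - h j)) with hQ
  have hd : derivative (genP r h) = ∑ i, Q i * C (h i) := by
    unfold genP
    rw [Polynomial.derivative_prod_finset]
    simp [hQ]
  have hfac : ∀ i, genP r h = (C (h i) * X + C (r - h i)) * Q i := by
    intro i
    exact (Finset.mul_prod_erase univ _ (mem_univ i)).symm
  have hA : ∑ i, h i * (Q i).coeff m = ((m : ℝ) + 1) * (genP r h).coeff (m + 1) := by
    have := congrArg (fun p => Polynomial.coeff p m) hd
    simp only [Polynomial.coeff_derivative, Polynomial.finsetSum_coeff,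
      Polynomial.coeff_mul_C] at this
    rw [mul_comm, this]
    exact Finset.sum_congr rfl fun i _ => mul_comm _ _
  have hB : ∑ i, h i * (X * Q i).coeff m = (m : ℝ) * (genP r h).coeff m := by
    cases m with
    | zero => simp
    | succ k =>
      have := congrArg (fun p => Polynomial.coeff p k) hd
      simp only [Polynomial.coeff_derivative, Polynomial.finsetSum_coeff,
        Polynomial.coeff_mul_C] at this
      push_cast
      rw [mul_comm, this]
      exact Finset.sum_congr rfl fun i _ => by rw [Polynomial.coeff_X_mul, mul_comm]
  have hP : ∀ i, (genP r h).coeff m = h i * (X * Q i).coeff m + (r - h i) * (Q i).coeff m := by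
    intro i
    rw [hfac i, add_mul, Polynomial.coeff_add, Polynomial.coeff_C_mul, mul_assoc,
      Polynomial.coeff_C_mul]
  have hQ0 : ∀ i k, 0 ≤ (Q i).coeff k := fun i k => coeff_nonneg_prod r h hh _ k
  have hX0 : ∀ i, 0 ≤ (X * Q i).coeff m := by
    intro i
    cases m with
    | zero => simp
    | succ k => rw [Polynomial.coeff_X_mul]; exact hQ0 i k
  have hP0 : 0 ≤ (genP r h).coeff m := coeff_nonneg_prod r h hh _ m
  have hterm : ∀ i ∈ (univ : Finset (Fin n)),
      h i * (genP r h).coeff m - a * (h i * (X * Q i).coeff m) ≤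
        (r - b) * (h i * (Q i).coeff m) := by
    intro i _
    rw [hP i]
    have h1 := mul_nonneg (mul_nonneg (hh i).1 (hX0 i)) (sub_nonneg.2 (ha i))
    have h2 := mul_nonneg (mul_nonneg (hh i).1 (hQ0 i m)) (sub_nonneg.2 (hb i))
    nlinarith
  have hS := Finset.sum_le_sum hterm
  rw [Finset.sum_sub_distrib, ← Finset.sum_mul, ← Finset.mul_sum, ← Finset.mul_sum, hA, hB] at hS
  have h3 := mul_le_mul_of_nonneg_right hs hP0
  have h4 : (((m : ℝ) + 1) * (r - b)) * (genP r h).coeff m ≤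
      (((m : ℝ) + 1) * (r - b)) * (genP r h).coeff (m + 1) := by nlinarith
  exact le_of_mul_le_mul_left h4 (mul_pos (by positivity) (by linarith))

open Polynomial in
lemma sum_coeff_mul (P : Polynomial ℝ) (a b : ℝ) (m : ℕ) :
    ∑ k ∈ range (m + 1), (P * (C a * X + C b)).coeff k =
      a * ∑ k ∈ range m, P.coeff k + b * ∑ k ∈ range (m + 1), P.coeff k := by
  have h : P * (C a * X + C b) = C a * (X * P) + C b * P := by ring
  rw [h]
  simp only [Polynomial.coeff_add, Polynomial.coeff_C_mul, Finset.sum_add_distrib,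
    ← Finset.mul_sum]
  have h2 : ∑ k ∈ range (m + 1), (X * P).coeff k = ∑ k ∈ range m, P.coeff k := by
    rw [Finset.sum_range_succ']
    simp [Polynomial.coeff_X_mul]
  rw [h2]

open Polynomial in
lemma sum_split {n : ℕ} (r : ℝ) (g : Fin (n + 2) → ℝ) (m : ℕ) :
    ∑ k ∈ range (m + 2), Mfun r g k =
      g (Fin.last (n + 1)) * (g (Fin.last n).castSucc *
          ∑ k ∈ range m, (genP r (fun i : Fin n => g i.castSucc.castSucc)).coeff k +
        (r - g (Fin.last n).castSucc) *
          ∑ k ∈ range (m + 1), (genP r (fun i : Fin n => g i.castSucc.castSucc)).coeff k) +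
      (r - g (Fin.last (n + 1))) * (g (Fin.last n).castSucc *
          ∑ k ∈ range (m + 1), (genP r (fun i : Fin n => g i.castSucc.castSucc)).coeff k +
        (r - g (Fin.last n).castSucc) *
          ∑ k ∈ range (m + 2), (genP r (fun i : Fin n => g i.castSucc.castSucc)).coeff k) := by
  simp only [Mfun_eq_coeff]
  have : genP r g = genP r (fun i : Fin n => g i.castSucc.castSucc) *
      (C (g (Fin.last n).castSucc) * X + C (r - g (Fin.last n).castSucc)) *
      (C (g (Fin.last (n + 1))) * X + C (r - g (Fin.last (n + 1)))) := by
    unfold genP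
    rw [Fin.prod_univ_castSucc, Fin.prod_univ_castSucc]
  rw [this, sum_coeff_mul, sum_coeff_mul, sum_coeff_mul]

theorem claim_averaging_increases_M
    (r : ℝ) (hr : 0 < r) (c : ℕ) (hc : 4 ≤ c) (q : ℕ) (hq0 : 0 < q)
    (g : Fin (c - 1) → ℝ) (hg : ∀ i, 0 ≤ g i ∧ g i ≤ r)
    (hmax : ∀ i, g i ≤ g ⟨c - 2, by omega⟩)
    (hmin : ∀ i, g ⟨c - 3, by omega⟩ ≤ g i)
    (hq : Nat.card {i : Fin (c - 1) // (i : ℕ) < c - 3 ∧ g i = r} + 1 ≤ q)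
    (hsum : ∑ i, g i ≥
      (q : ℝ) * (r + g ⟨c - 2, by omega⟩ - g ⟨c - 3, by omega⟩) +
        g ⟨c - 3, by omega⟩) :
    ∑ k ∈ Finset.range (q + 1), Mfun r g k ≤
      ∑ k ∈ Finset.range (q + 1),
        Mfun r
          (fun i => if (i : ℕ) < c - 3 then g i
            else (g ⟨c - 3, by omega⟩ + g ⟨c - 2, by omega⟩) / 2) k := by
  obtain ⟨n, rfl⟩ : ∃ n, c = n + 3 := ⟨c - 3, by omega⟩
  obtain ⟨m, rfl⟩ : ∃ m, q = m + 1 := ⟨q - 1, by omega⟩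
  change Fin (n + 2) → ℝ at g
  have e1 : (⟨n + 3 - 2, by omega⟩ : Fin (n + 2)) = Fin.last (n + 1) := rfl
  have e2 : (⟨n + 3 - 3, by omega⟩ : Fin (n + 2)) = (Fin.last n).castSucc := rfl
  change ∀ i : Fin (n + 2), g i ≤ g (Fin.last (n + 1)) at hmax
  change ∀ i : Fin (n + 2), g (Fin.last n).castSucc ≤ g i at hmin
  change ∑ i : Fin (n + 2), g i ≥ ((m + 1 : ℕ) : ℝ) *
    (r + g (Fin.last (n + 1)) - g (Fin.last n).castSucc) + g (Fin.last n).castSucc at hsum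
  change ∑ k ∈ range (m + 2), Mfun r g k ≤ ∑ k ∈ range (m + 2),
    Mfun r (fun i : Fin (n + 2) => if (i : ℕ) < n then g i else
      (g (Fin.last n).castSucc + g (Fin.last (n + 1))) / 2) k
  rw [sum_split, sum_split]
  have hP : (fun i : Fin n => if ((i.castSucc.castSucc : Fin (n + 2)) : ℕ) < n then
      g i.castSucc.castSucc else
      (g (Fin.last n).castSucc + g (Fin.last (n + 1))) / 2) =
      fun i : Fin n => g i.castSucc.castSucc := by
    funext i
    simp
  rw [hP]
  have h1 : ¬ (((Fin.last (n + 1) : Fin (n + 2)) : ℕ) < n) := by simp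
  have h2 : ¬ ((((Fin.last n).castSucc : Fin (n + 2)) : ℕ) < n) := by simp
  simp only [h1, h2, if_false]
  rw [Fin.sum_univ_castSucc, Fin.sum_univ_castSucc] at hsum
  have hk := key r (fun i : Fin n => g i.castSucc.castSucc) (fun i => hg _) m
    (g (Fin.last (n + 1))) (g (Fin.last n).castSucc) (fun i => hmin _) (fun i => hmax _)
  have hba := hmin (Fin.last (n + 1))
  have har := (hg (Fin.last (n + 1))).2
  change g (Fin.last (n + 1)) ≤ r at har
  rw [Finset.sum_range_succ _ (m + 1), Finset.sum_range_succ _ m]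
  generalize (∑ k ∈ range m, (genP r (fun i : Fin n => g i.castSucc.castSucc)).coeff k) = S
  generalize g (Fin.last (n + 1)) = a at *
  generalize g (Fin.last n).castSucc = b at *
  rcases hba.lt_or_eq with hlt | heq
  · have hk' := hk (by linarith) (by push_cast at hsum; linarith)
    have := mul_nonneg (sq_nonneg (a - b)) (sub_nonneg.2 hk')
    nlinarith
  · subst heq
    apply le_of_eq
    ring
end

section
/- Let r > 0 be a real number, let s ≥ 1 be an integer, and let g_1,…,g_s be real numbers with 0 ≤ g_i ≤ r. Let p_r = |{i : g_i = r}|, let T = {i : 0 < g_i < r}, t = |T|, and let q be an integer with p_r + 1 ≤ q ≤ t + p_r. If every subset I ⊆ T with |I| = t − (q − p_r) + 1 satisfies Σ_{i∈I} g_i/(r − g_i) ≥ q − p_r, then M(g_1,…,g_s; q−1) ≤ M(g_1,…,g_s; q). -/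
open Finset

/-- let `0 < r`, `s ≥ 1`, `g₁,…,g_s ∈ [0,r]`,
`p_r = |{i : g_i = r}|`, `T = {i : 0 < g_i < r}`, `t = |T|` and
`p_r + 1 ≤ q ≤ t + p_r`.  If every `I ⊆ T` with `|I| = t − (q − p_r) + 1`
satisfies `Σ_{i∈I} g_i/(r − g_i) ≥ q − p_r`, then `M(g;q−1) ≤ M(g;q)`. -/
theorem M_monotone_step
    (r : ℝ) (hr : 0 < r) (s : ℕ) (hs : 1 ≤ s)
    (g : Fin s → ℝ) (hg : ∀ i, 0 ≤ g i ∧ g i ≤ r)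
    (q : ℕ)
    (hq1 : Nat.card {i : Fin s // g i = r} + 1 ≤ q)
    (hq2 : q ≤ Nat.card {i : Fin s // 0 < g i ∧ g i < r} +
      Nat.card {i : Fin s // g i = r})
    (hI : ∀ I : Finset (Fin s), (∀ i ∈ I, 0 < g i ∧ g i < r) →
      I.card = Nat.card {i : Fin s // 0 < g i ∧ g i < r} -
          (q - Nat.card {i : Fin s // g i = r}) + 1 →
      ∑ i ∈ I, g i / (r - g i) ≥
        (q : ℝ) - (Nat.card {i : Fin s // g i = r} : ℝ)) :
    Mfun r g (q - 1) ≤ Mfun r g q := by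
  classical
  set P : Finset (Fin s) := univ.filter (fun i => g i = r) with hP
  set T : Finset (Fin s) := univ.filter (fun i => 0 < g i ∧ g i < r) with hT
  have hPc : Nat.card {i : Fin s // g i = r} = P.card := by
    rw [Nat.card_eq_fintype_card, Fintype.card_subtype]
  have hTc : Nat.card {i : Fin s // 0 < g i ∧ g i < r} = T.card := by
    rw [Nat.card_eq_fintype_card, Fintype.card_subtype]
  rw [hPc] at hq1 hq2 hI
  rw [hTc] at hq2 hI
  have hPT : Disjoint P T := by
    rw [Finset.disjoint_left]
    intro i hi hi2
    simp only [hP, hT, mem_filter, mem_univ, true_and] at hi hi2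
    linarith [hi2.2]
  let W : Finset (Fin s) → ℝ := fun I => (∏ i ∈ I, g i) * ∏ i ∈ Iᶜ, (r - g i)
  have hW0 : ∀ I, 0 ≤ W I := fun I =>
    mul_nonneg (prod_nonneg fun i _ => (hg i).1)
      (prod_nonneg fun i _ => sub_nonneg.2 (hg i).2)
  have hWne : ∀ I, W I ≠ 0 → (I ∩ T).card + P.card = I.card := by
    intro I hne
    have h1 := left_ne_zero_of_mul hne
    have h2 := right_ne_zero_of_mul hne
    rw [prod_ne_zero_iff] at h1 h2
    have : I = (I ∩ T) ∪ P := by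
      ext i
      have a1 := h1 i
      have a2 := h2 i
      have a3 := hg i
      simp only [mem_compl, mem_union, mem_inter, hP, hT, mem_filter, mem_univ, true_and] at *
      constructor
      · intro hi
        by_cases h : g i = r
        · exact Or.inr h
        · exact Or.inl ⟨hi, lt_of_le_of_ne a3.1 (Ne.symm (a1 hi)), lt_of_le_of_ne a3.2 h⟩
      · rintro (h | h)
        · exact h.1
        · by_contra hn
          exact a2 hn (by rw [h, sub_self])
    have hd : Disjoint (I ∩ T) P := (hPT.mono_right inter_subset_right).symm
    have h3 := card_union_of_disjoint hd
    rw [← this] at h3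
    exact h3.symm
  have hins : ∀ I : Finset (Fin s), ∀ i ∈ T, i ∉ I →
      W (insert i I) = W I * (g i / (r - g i)) := by
    intro I i hi hiI
    have hri : r - g i ≠ 0 := by
      simp only [hT, mem_filter, mem_univ, true_and] at hi
      linarith [hi.2]
    have hc : Iᶜ = insert i (insert i I)ᶜ := by
      ext j
      simp only [mem_compl, mem_insert]
      by_cases h : j = i
      · simp [h, hiI]
      · simp [h]
    simp only [W]
    rw [prod_insert hiI, hc, prod_insert (by simp)]
    field_simp
  have key : ∑ I ∈ powersetCard (q - 1) univ, ∑ i ∈ T \ I, W I * (g i / (r - g i))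
      = ∑ J ∈ powersetCard q univ, ∑ _i ∈ J ∩ T, W J := by
    rw [sum_sigma', sum_sigma']
    refine sum_bij' (fun x _ => ⟨insert x.2 x.1, x.2⟩) (fun x _ => ⟨x.1.erase x.2, x.2⟩)
      ?_ ?_ ?_ ?_ ?_
    · rintro ⟨I, i⟩ h
      simp only [mem_sigma, mem_powersetCard_univ, mem_sdiff, mem_inter, mem_insert] at h ⊢
      rw [card_insert_of_notMem h.2.2]
      exact ⟨by omega, Or.inl trivial, h.2.1⟩
    · rintro ⟨I, i⟩ h
      simp only [mem_sigma, mem_powersetCard_univ, mem_sdiff, mem_inter] at h ⊢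
      rw [card_erase_of_mem h.2.1]
      exact ⟨by omega, h.2.2, by simp⟩
    · rintro ⟨I, i⟩ h
      simp only [mem_sigma, mem_sdiff] at h
      simp [erase_insert h.2.2]
    · rintro ⟨I, i⟩ h
      simp only [mem_sigma, mem_inter] at h
      simp [insert_erase h.2.1]
    · rintro ⟨I, i⟩ h
      simp only [mem_sigma, mem_sdiff] at h
      exact (hins I i h.2.1 h.2.2).symm
  have hR : ∑ J ∈ powersetCard q univ, ∑ _i ∈ J ∩ T, W J
      = ((q : ℝ) - P.card) * Mfun r g q := by
    unfold Mfun
    rw [mul_sum]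
    refine sum_congr rfl fun J hJ => ?_
    rw [mem_powersetCard_univ] at hJ
    change _ = _ * W J
    rw [sum_const, nsmul_eq_mul]
    by_cases h : W J = 0
    · simp [h]
    · have h1 := hWne J h
      rw [hJ] at h1
      rw [← h1]
      push_cast
      ring
  have hL : ((q : ℝ) - P.card) * Mfun r g (q - 1) ≤
      ∑ I ∈ powersetCard (q - 1) univ, ∑ i ∈ T \ I, W I * (g i / (r - g i)) := by
    unfold Mfun
    rw [mul_sum]
    refine sum_le_sum fun I hI' => ?_
    rw [mem_powersetCard_univ] at hI'
    change _ * W I ≤ _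
    rw [← mul_sum, mul_comm]
    by_cases h : W I = 0
    · simp [h]
    · refine mul_le_mul_of_nonneg_left ?_ (hW0 I)
      have h1 := hWne I h
      refine hI (T \ I) (fun i hi => ?_) ?_
      · simpa [hT] using (mem_sdiff.1 hi).1
      · rw [card_sdiff]
        omega
  have hpos : (0 : ℝ) < (q : ℝ) - P.card := by
    have : ((P.card + 1 : ℕ) : ℝ) ≤ q := by exact_mod_cast hq1
    push_cast at this
    linarith
  rw [key, hR] at hL
  exact le_of_mul_le_mul_left hL hpos
end

section
/- Let c ≥ 10 be an integer, set q = ⌊(c−2)/4⌋, and let p, m be positive real numbers with p(c−1−q) − m(q+1) > 0. Then Σ_{k=0}^{q} C(c−1, k) (p/m)^k < C(c−1, q) · (p/m)^q · p(c−1−q) / (p(c−1−q) − m(q+1)). -/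
open Finset

theorem aux_bound (n q : ℕ) (p m : ℝ) (hp : 0 < p) (hm : 0 < m) (hqn : q ≤ n) :
    ∀ j : ℕ, j ≤ q →
    (∑ k ∈ Finset.range (j + 1), (n.choose k : ℝ) * (p / m) ^ k) *
      (p * ((n : ℝ) - q) - m * ((q : ℝ) + 1)) <
    (n.choose j : ℝ) * (p / m) ^ j * (p * ((n : ℝ) - q)) ∨
      p * ((n : ℝ) - q) - m * ((q : ℝ) + 1) ≤ 0 := by
  intro j
  by_cases hD : p * ((n : ℝ) - q) - m * ((q : ℝ) + 1) ≤ 0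
  · intro _
    exact Or.inr hD
  induction j with
  | zero =>
    intro _
    left
    have : 0 < m * ((q : ℝ) + 1) := by positivity
    simp
    linarith
  | succ j ih =>
    intro hj
    left
    have ih' := (ih (by omega)).resolve_right hD
    rw [Finset.sum_range_succ, add_mul]
    have hrec : (n.choose (j + 1) : ℝ) * ((j : ℝ) + 1) = n.choose j * ((n : ℝ) - j) := by
      have h1 := Nat.choose_succ_right_eq n j
      have h2 : ((n - j : ℕ) : ℝ) = (n : ℝ) - j := Nat.cast_sub (by omega)
      rw [← h2]
      exact_mod_cast h1
    have hjq : (j : ℝ) + 1 ≤ q := by exact_mod_cast hj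
    have ha : (0 : ℝ) ≤ (n.choose j : ℝ) * (p / m) ^ j := by positivity
    have hb : (0 : ℝ) ≤ (n.choose (j + 1) : ℝ) * (p / m) ^ (j + 1) := by positivity
    have hr2 : (n.choose (j + 1) : ℝ) * (p / m) ^ (j + 1) * (m * ((j : ℝ) + 1)) =
        (n.choose j : ℝ) * (p / m) ^ j * (p * ((n : ℝ) - j)) := by
      have hx : p / m * m = p := by field_simp
      calc _ = ((n.choose (j + 1) : ℝ) * ((j : ℝ) + 1)) * (p / m) ^ j * (p / m * m) := by ring
        _ = _ := by rw [hrec, hx]; ring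
    have h3 : (n.choose (j + 1) : ℝ) * (p / m) ^ (j + 1) * (m * ((j : ℝ) + 1)) ≤
        (n.choose (j + 1) : ℝ) * (p / m) ^ (j + 1) * (m * ((q : ℝ) + 1)) := by
      apply mul_le_mul_of_nonneg_left _ hb
      apply mul_le_mul_of_nonneg_left _ hm.le
      linarith
    have h4 : (n.choose j : ℝ) * (p / m) ^ j * (p * ((n : ℝ) - q)) ≤
        (n.choose j : ℝ) * (p / m) ^ j * (p * ((n : ℝ) - j)) := by
      apply mul_le_mul_of_nonneg_left _ ha
      apply mul_le_mul_of_nonneg_left _ hp.le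
      linarith
    rw [mul_sub ((n.choose (j + 1) : ℝ) * (p / m) ^ (j + 1))]
    linarith

/-- for `c ≥ 10`, `q = ⌊(c−2)/4⌋` and reals `p, m > 0` with
`p(c−1−q) − m(q+1) > 0`,
`Σ_{k=0}^{q} C(c−1,k)(p/m)^k
  < C(c−1,q)·(p/m)^q·p(c−1−q)/(p(c−1−q) − m(q+1))`. -/
theorem partial_binomial_sum_bound
    (c : ℕ) (hc : 10 ≤ c) (p m : ℝ) (hp : 0 < p) (hm : 0 < m)
    (h : p * ((c : ℝ) - 1 - (((c - 2) / 4 : ℕ) : ℝ)) -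
        m * ((((c - 2) / 4 : ℕ) : ℝ) + 1) > 0) :
    ∑ k ∈ Finset.range ((c - 2) / 4 + 1), ((c - 1).choose k : ℝ) * (p / m) ^ k <
      ((c - 1).choose ((c - 2) / 4) : ℝ) * (p / m) ^ ((c - 2) / 4) *
        (p * ((c : ℝ) - 1 - (((c - 2) / 4 : ℕ) : ℝ))) /
        (p * ((c : ℝ) - 1 - (((c - 2) / 4 : ℕ) : ℝ)) -
          m * ((((c - 2) / 4 : ℕ) : ℝ) + 1)) := by
  have hn : ((c - 1 : ℕ) : ℝ) = (c : ℝ) - 1 := by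
    rw [Nat.cast_sub (by omega)]; simp
  have key := aux_bound (c - 1) ((c - 2) / 4) p m hp hm (by omega) ((c - 2) / 4) le_rfl
  rw [hn] at key
  rw [lt_div_iff₀ h]
  exact key.resolve_right (not_le.mpr h)
end

section
/- For every integer c ≥ 10, C(c−1, ⌊(c−2)/4⌋) ≤ (9/(7√c)) · (4/3^(3/4))^(c−1) · ((2c−4)/(3c−2)). -/
/-- Squared form of the bound, with `m = c - 1` and `y = x ^ 2`. -/
def CBP (y : ℝ) (m k : ℕ) : Prop :=
  (m.choose k : ℝ) ^ 2 * ((m + 1) * 49 * (3 * m + 1) ^ 2) ≤ 81 * y ^ m * (2 * m - 2) ^ 2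

theorem CBP_step (y : ℝ) (hy : 3 ≤ y) (m k : ℕ) (hm : 9 ≤ m) (hk : 4 * k + 1 ≤ m)
    (h : CBP y m k) : CBP y (m + 1) k := by
  unfold CBP at *
  have e : ((m + 1).choose k : ℝ) * ((m : ℝ) + 1 - k) = (m.choose k : ℝ) * (m + 1) := by
    have := Nat.choose_mul_succ_eq m k
    have h2 : k ≤ m + 1 := by omega
    have h3 : ((m.choose k * (m + 1) : ℕ) : ℝ) = (((m + 1).choose k * (m + 1 - k) : ℕ) : ℝ) := by
      rw [this]
    rw [Nat.cast_mul, Nat.cast_mul, Nat.cast_sub h2] at h3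
    push_cast at h3
    linarith
  have hkr : 4 * (k : ℝ) + 1 ≤ m := by exact_mod_cast hk
  have hmr : (9 : ℝ) ≤ m := by exact_mod_cast hm
  set A : ℝ := (m.choose k : ℝ)
  set B : ℝ := ((m + 1).choose k : ℝ)
  have hA : 0 ≤ A := by positivity
  have hB : 0 ≤ B := by positivity
  have hBA : B ≤ 4 / 3 * A := by
    have h1 : B * (3 * ((m : ℝ) + 1) / 4) ≤ A * (m + 1) := by
      rw [← e]; apply mul_le_mul_of_nonneg_left _ hB; linarith
    have h2 : 0 < (m : ℝ) + 1 := by linarith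
    by_contra hcon
    push Not at hcon
    nlinarith
  have hB2 : B ^ 2 ≤ 16 / 9 * A ^ 2 := by nlinarith
  push_cast
  set t : ℝ := (m : ℝ)
  have ht0 : 0 < 2 * t - 2 := by linarith
  have hY : 0 ≤ y ^ m := by positivity
  have key : 16 / 9 * ((t + 1 + 1) * 49 * (3 * (t + 1) + 1) ^ 2) * (2 * t - 2) ^ 2
      ≤ 3 * ((t + 1) * 49 * (3 * t + 1) ^ 2) * (2 * (t + 1) - 2) ^ 2 := by
    clear_value t
    obtain ⟨s, hs, rfl⟩ : ∃ s : ℝ, 0 ≤ s ∧ t = s + 9 := ⟨t - 9, by linarith, by ring⟩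
    rw [← sub_nonneg]; ring_nf; positivity
  have hpos : 0 < (2 * t - 2) ^ 2 := by positivity
  refine le_of_mul_le_mul_right ?_ hpos
  calc B ^ 2 * ((t + 1 + 1) * 49 * (3 * (t + 1) + 1) ^ 2) * (2 * t - 2) ^ 2
      ≤ (16 / 9 * A ^ 2) * ((t + 1 + 1) * 49 * (3 * (t + 1) + 1) ^ 2) * (2 * t - 2) ^ 2 := by
        gcongr
    _ = A ^ 2 * (16 / 9 * ((t + 1 + 1) * 49 * (3 * (t + 1) + 1) ^ 2) * (2 * t - 2) ^ 2) := by ring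
    _ ≤ A ^ 2 * (3 * ((t + 1) * 49 * (3 * t + 1) ^ 2) * (2 * (t + 1) - 2) ^ 2) := by gcongr
    _ = 3 * (2 * (t + 1) - 2) ^ 2 * (A ^ 2 * ((t + 1) * 49 * (3 * t + 1) ^ 2)) := by ring
    _ ≤ 3 * (2 * (t + 1) - 2) ^ 2 * (81 * y ^ m * (2 * t - 2) ^ 2) := by gcongr
    _ ≤ y * (2 * (t + 1) - 2) ^ 2 * (81 * y ^ m * (2 * t - 2) ^ 2) := by gcongr
    _ = _ := by ring

theorem CBP_choose (k : ℕ) : ((4 * (k + 1) + 1).choose (k + 1) : ℝ) *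
    ((k + 1) * ((3 * k + 4) * (3 * k + 3) * (3 * k + 2))) =
    ((4 * k + 1).choose k : ℝ) * ((4 * k + 5) * (4 * k + 4) * (4 * k + 3) * (4 * k + 2)) := by
  have h1 := Nat.add_one_mul_choose_eq (4 * k + 4) k
  have h2 := Nat.choose_mul_succ_eq (4 * k + 3) k
  have h3 := Nat.choose_mul_succ_eq (4 * k + 2) k
  have h4 := Nat.choose_mul_succ_eq (4 * k + 1) k
  rw [show 4 * k + 3 + 1 - k = 3 * k + 4 by omega] at h2
  rw [show 4 * k + 2 + 1 - k = 3 * k + 3 by omega] at h3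
  rw [show 4 * k + 1 + 1 - k = 3 * k + 2 by omega] at h4
  simp only [show 4 * k + 4 + 1 = 4 * (k + 1) + 1 by ring, Nat.add_assoc, Nat.reduceAdd] at *
  rify at h1 h2 h3 h4
  linear_combination (-(3 * (k:ℝ) + 4) * (3 * k + 3) * (3 * k + 2)) * h1
    - (4 * (k:ℝ) + 5) * (3 * k + 3) * (3 * k + 2) * h2
    - (4 * (k:ℝ) + 5) * (4 * k + 4) * (3 * k + 2) * h3
    - (4 * (k:ℝ) + 5) * (4 * k + 4) * (4 * k + 3) * h4

theorem CBP_main (y : ℝ) (hy : 307 / 100 ≤ y) (hy2 : y ^ 2 = 256 / 27) (k : ℕ) (hk : 2 ≤ k) :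
    CBP y (4 * k + 1) k := by
  induction k, hk using Nat.le_induction with
  | base =>
    unfold CBP
    have : y ^ 9 = (256 / 27) ^ 4 * y := by rw [← hy2]; ring
    norm_num [Nat.choose, this]
    linarith
  | succ k hk ih =>
    unfold CBP at *
    have e := CBP_choose k
    have hkr : (2 : ℝ) ≤ k := by exact_mod_cast hk
    have hp : y ^ (4 * (k + 1) + 1) = y ^ (4 * k + 1) * (256 / 27) ^ 2 := by rw [← hy2]; ring
    rw [hp]
    have hY : 0 ≤ y ^ (4 * k + 1) := by positivity
    push_cast at *
    set A : ℝ := ((4 * k + 1).choose k : ℝ)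
    set B : ℝ := ((4 * (k + 1) + 1).choose (k + 1) : ℝ)
    set Y := y ^ (4 * k + 1)
    set t : ℝ := (k : ℝ)
    set D : ℝ := (t + 1) * ((3 * t + 4) * (3 * t + 3) * (3 * t + 2)) with hD
    set N : ℝ := (4 * t + 5) * (4 * t + 4) * (4 * t + 3) * (4 * t + 2) with hN
    have hDpos : 0 < D := by positivity
    have e2 : B ^ 2 * D ^ 2 = A ^ 2 * N ^ 2 := by
      rw [← mul_pow, e, mul_pow]
    have hpos : 0 < D ^ 2 * (2 * (4 * t + 1) - 2) ^ 2 := by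
      have : 0 < 2 * (4 * t + 1) - 2 := by linarith
      positivity
    have key : N ^ 2 * ((4 * (t + 1) + 1 + 1) * 49 * (3 * (4 * (t + 1) + 1) + 1) ^ 2)
          * (2 * (4 * t + 1) - 2) ^ 2
        ≤ (256 / 27) ^ 2 * (2 * (4 * (t + 1) + 1) - 2) ^ 2 * D ^ 2 *
          ((4 * t + 1 + 1) * 49 * (3 * (4 * t + 1) + 1) ^ 2) := by
      rw [hD, hN]
      clear_value t
      obtain ⟨s, hs, rfl⟩ : ∃ s : ℝ, 0 ≤ s ∧ t = s + 2 := ⟨t - 2, by linarith, by ring⟩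
      rw [← sub_nonneg]; ring_nf; positivity
    refine le_of_mul_le_mul_right ?_ hpos
    calc B ^ 2 * ((4 * (t + 1) + 1 + 1) * 49 * (3 * (4 * (t + 1) + 1) + 1) ^ 2) *
          (D ^ 2 * (2 * (4 * t + 1) - 2) ^ 2)
        = (B ^ 2 * D ^ 2) * (((4 * (t + 1) + 1 + 1) * 49 * (3 * (4 * (t + 1) + 1) + 1) ^ 2) *
          (2 * (4 * t + 1) - 2) ^ 2) := by ring
      _ = A ^ 2 * (N ^ 2 * ((4 * (t + 1) + 1 + 1) * 49 * (3 * (4 * (t + 1) + 1) + 1) ^ 2)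
          * (2 * (4 * t + 1) - 2) ^ 2) := by rw [e2]; ring
      _ ≤ A ^ 2 * ((256 / 27) ^ 2 * (2 * (4 * (t + 1) + 1) - 2) ^ 2 * D ^ 2 *
          ((4 * t + 1 + 1) * 49 * (3 * (4 * t + 1) + 1) ^ 2)) := by gcongr
      _ = (256 / 27) ^ 2 * (2 * (4 * (t + 1) + 1) - 2) ^ 2 * D ^ 2 *
          (A ^ 2 * ((4 * t + 1 + 1) * 49 * (3 * (4 * t + 1) + 1) ^ 2)) := by ring
      _ ≤ (256 / 27) ^ 2 * (2 * (4 * (t + 1) + 1) - 2) ^ 2 * D ^ 2 *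
          (81 * Y * (2 * (4 * t + 1) - 2) ^ 2) := by gcongr
      _ = _ := by ring

/-- for every integer `c ≥ 10`,
`C(c−1, ⌊(c−2)/4⌋) ≤ (9/(7√c))·(4/3^(3/4))^(c−1)·((2c−4)/(3c−2))`. -/
theorem central_binomial_floor_bound (c : ℕ) (hc : 10 ≤ c) :
    ((c - 1).choose ((c - 2) / 4) : ℝ) ≤
      (9 / (7 * Real.sqrt c)) * (4 / (3 : ℝ) ^ ((3 : ℝ) / 4)) ^ (c - 1) *
        ((2 * (c : ℝ) - 4) / (3 * (c : ℝ) - 2)) := by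
  set x : ℝ := 4 / (3 : ℝ) ^ ((3 : ℝ) / 4) with hx
  have hx0 : 0 < x := by positivity
  have hx4 : x ^ 4 = 256 / 27 := by
    rw [hx, div_pow, ← Real.rpow_natCast ((3 : ℝ) ^ ((3 : ℝ) / 4)) 4, ← Real.rpow_mul (by norm_num)]
    norm_num
  have hy2 : (x ^ 2) ^ 2 = 256 / 27 := by rw [← hx4]; ring
  have hy : 307 / 100 ≤ x ^ 2 := by
    by_contra hcon
    push Not at hcon
    have : 0 < x ^ 2 := by positivity
    nlinarith
  have hy3 : 3 ≤ x ^ 2 := by linarith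
  have hP : CBP (x ^ 2) (c - 1) ((c - 2) / 4) := by
    obtain ⟨k, hk⟩ : ∃ k, k = (c - 2) / 4 := ⟨_, rfl⟩
    rw [← hk]
    have hk2 : 2 ≤ k := by omega
    have h1 := CBP_main (x ^ 2) hy hy2 k hk2
    have h2 := CBP_step _ hy3 _ k (by omega) (by omega) h1
    have h3 := CBP_step _ hy3 _ k (by omega) (by omega) h2
    have h4 := CBP_step _ hy3 _ k (by omega) (by omega) h3
    have : c - 1 = 4 * k + 1 ∨ c - 1 = 4 * k + 1 + 1 ∨ c - 1 = 4 * k + 1 + 1 + 1 ∨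
      c - 1 = 4 * k + 1 + 1 + 1 + 1 := by omega
    rcases this with h | h | h | h <;> rw [h] <;> assumption
  unfold CBP at hP
  rw [Nat.cast_sub (by omega : 1 ≤ c)] at hP
  have hcr : (10 : ℝ) ≤ c := by exact_mod_cast hc
  set A : ℝ := ((c - 1).choose ((c - 2) / 4) : ℝ)
  have hs : 0 < Real.sqrt c := Real.sqrt_pos.mpr (by linarith)
  have hs2 : Real.sqrt c ^ 2 = c := Real.sq_sqrt (by linarith)
  have hd : 0 < 3 * (c : ℝ) - 2 := by linarith
  have hn : 0 ≤ 2 * (c : ℝ) - 4 := by linarith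
  have e : (9 / (7 * Real.sqrt c)) * x ^ (c - 1) * ((2 * (c : ℝ) - 4) / (3 * (c : ℝ) - 2)) =
      (9 * x ^ (c - 1) * (2 * (c : ℝ) - 4)) / (7 * Real.sqrt c * (3 * c - 2)) := by
    field_simp
  rw [e, le_div_iff₀ (by positivity)]
  refine abs_le_of_sq_le_sq' ?_ (by positivity) |>.2
  have e3 : (x ^ 2) ^ (c - 1) = (x ^ (c - 1)) ^ 2 := by rw [← pow_mul, ← pow_mul, mul_comm]
  rw [e3] at hP
  push_cast at hP
  calc (A * (7 * Real.sqrt c * (3 * c - 2))) ^ 2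
      = A ^ 2 * (49 * Real.sqrt c ^ 2 * (3 * c - 2) ^ 2) := by ring
    _ = A ^ 2 * (((c : ℝ) - 1 + 1) * 49 * (3 * (c - 1) + 1) ^ 2) := by rw [hs2]; ring
    _ ≤ _ := hP
    _ = _ := by ring
end

section
/- Every tournament on c ≥ 2 vertices that is not strongly connected contains a vertex x with min{d^+(x), d^−(x)} ≤ ⌊(c−2)/4⌋, i.e., a vertex whose out-degree or in-degree is at most ⌊(c−2)/4⌋. -/
theorem aux_closed_low {c : ℕ} (R : Fin c → Fin c → Prop)
    (hirr : ∀ v, ¬ R v v)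
    (hone : ∀ u v : Fin c, u ≠ v → (R u v ↔ ¬ R v u))
    (S : Finset (Fin c)) (hS : S.Nonempty) (hcl : ∀ x ∈ S, ∀ y, R x y → y ∈ S) :
    ∃ x ∈ S, 2 * Nat.card {y : Fin c // R x y} + 1 ≤ S.card := by
  classical
  have key : ∀ x ∈ S, (S.filter (fun y => R x y)).card + (S.filter (fun y => R y x)).card + 1
      = S.card := by
    intro x hx
    have h1 : S.filter (fun y => ¬ R x y) = insert x (S.filter (fun y => R y x)) := by
      ext y
      simp only [Finset.mem_filter, Finset.mem_insert]
      by_cases h : y = x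
      · subst h; simp [hx, hirr]
      · have := hone y x h
        tauto
    have h2 := Finset.card_filter_add_card_filter_not (s := S) (fun y => R x y)
    rw [h1, Finset.card_insert_of_notMem (by simp [hirr])] at h2
    omega
  have hsum : ∑ x ∈ S, (S.filter (fun y => R x y)).card
      = ∑ x ∈ S, (S.filter (fun y => R y x)).card :=
    Finset.sum_card_bipartiteAbove_eq_sum_card_bipartiteBelow R
  have hle : ∑ x ∈ S, (2 * (S.filter (fun y => R x y)).card + 1) ≤ ∑ x ∈ S, S.card := by
    rw [← Finset.sum_congr rfl key]
    simp only [Finset.sum_add_distrib, ← Finset.mul_sum]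
    omega
  obtain ⟨x, hx, h⟩ := Finset.exists_le_of_sum_le hS hle
  refine ⟨x, hx, ?_⟩
  have : Nat.card {y : Fin c // R x y} = (S.filter (fun y => R x y)).card := by
    rw [Nat.card_eq_fintype_card, Fintype.card_subtype]
    congr 1
    ext y
    simp only [Finset.mem_filter, Finset.mem_univ, true_and]
    exact ⟨fun h => ⟨hcl x hx y h, h⟩, fun h => h.2⟩
  omega

/-- every tournament on `c ≥ 2` vertices that is not strongly
connected has a vertex `x` with `min{d⁺(x), d⁻(x)} ≤ ⌊(c−2)/4⌋`. -/
theorem non_strong_tournament_has_low_degree_vertex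
    (c : ℕ) (hc : 2 ≤ c) (adj : Fin c → Fin c → Prop)
    (hirr : ∀ v, ¬ adj v v)
    (hone : ∀ u v : Fin c, u ≠ v → (adj u v ↔ ¬ adj v u))
    (hns : ¬ ∀ u v : Fin c, Relation.ReflTransGen adj u v) :
    ∃ x : Fin c,
      min (Nat.card {y : Fin c // adj x y}) (Nat.card {y : Fin c // adj y x}) ≤
        (c - 2) / 4 := by
  classical
  push Not at hns
  obtain ⟨u, v, huv⟩ := hns
  have hcard := Finset.card_filter_add_card_filter_not (s := (Finset.univ : Finset (Fin c)))
    (fun y => Relation.ReflTransGen adj u y)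
  rw [Finset.card_univ, Fintype.card_fin] at hcard
  obtain ⟨x, -, hx⟩ := aux_closed_low adj hirr hone
    (Finset.univ.filter (fun y => Relation.ReflTransGen adj u y))
    ⟨u, by simp [Relation.ReflTransGen.refl]⟩
    (fun x hx y h => by simp at hx ⊢; exact hx.tail h)
  obtain ⟨z, -, hz⟩ := aux_closed_low (fun a b => adj b a) hirr
    (fun a b h => hone b a (Ne.symm h))
    (Finset.univ.filter (fun y => ¬ Relation.ReflTransGen adj u y))
    ⟨v, by simp [huv]⟩
    (fun x hx y h => by simp at hx ⊢; exact fun h' => hx (h'.tail h))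
  by_contra! hcon
  have hx' := hcon x
  have hz' := hcon z
  rw [lt_min_iff] at hx' hz'
  omega
end

section
/- Let G_{r,c} be a balanced c-partite tournament with c ≥ 2 and r ≥ 1. If G_{r,c} has no strong partition, then ω(G_{r,c}) ≥ (r!)^(c−1). -/
open Finset

open scoped Classical in
theorem exists_low_out {V : Type*} (R : V → V → Prop) (hR : ∀ x y, R x y → ¬ R y x)
    (A : Finset V) (hA : A.Nonempty) :
    ∃ x ∈ A, 2 * (A.filter (fun y => R x y)).card + 1 ≤ A.card := by
  by_contra hcon
  push Not at hcon
  have hsum : ∑ x ∈ A, (A.filter (fun y => R x y)).card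
      = ∑ x ∈ A, (A.filter (fun y => R y x)).card := by
    simp only [Finset.card_filter]
    exact Finset.sum_comm
  have h1 : ∀ x ∈ A, (A.filter (fun y => R x y)).card + (A.filter (fun y => R y x)).card + 1
      ≤ A.card := by
    intro x hx
    have hd : Disjoint (A.filter (fun y => R x y)) (A.filter (fun y => R y x)) := by
      rw [Finset.disjoint_left]
      intro y hy hy'
      exact hR _ _ (Finset.mem_filter.1 hy).2 (Finset.mem_filter.1 hy').2
    rw [← Finset.card_union_of_disjoint hd, Nat.succ_le_iff]
    apply Finset.card_lt_card
    refine (Finset.ssubset_iff_of_subset ?_).2 ⟨x, hx, ?_⟩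
    · intro y hy
      simp only [Finset.mem_union, Finset.mem_filter] at hy
      tauto
    · simp only [Finset.mem_union, Finset.mem_filter]
      rintro (h | h) <;> exact hR _ _ h.2 h.2
  have h2 := Finset.sum_le_sum h1
  have h3 : ∑ x ∈ A, (A.card) ≤ ∑ x ∈ A, 2 * (A.filter (fun y => R x y)).card :=
    Finset.sum_le_sum (fun x hx => by have := hcon x hx; omega)
  rw [← Finset.mul_sum] at h3
  rw [Finset.sum_add_distrib, Finset.sum_add_distrib, ← hsum] at h2
  have h4 : 0 < ∑ x ∈ A, 1 := by simpa using hA.card_pos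
  omega

theorem MPT.adj_asymm {c r : ℕ} (T : MPT c r) (x y : Fin c × Fin r) (hxy : T.adj x y) :
    ¬ T.adj y x := by
  by_cases he : x.1 = y.1
  · exact absurd hxy (T.not_adj_same_part x y he)
  · exact (T.adj_iff x y he).1 hxy

theorem IsTransversal.card_eq {c r : ℕ} {S : Finset (Fin c × Fin r)} (hS : IsTransversal S) :
    S.card = c := by
  rw [Finset.card_eq_sum_card_fiberwise (f := Prod.fst) (t := Finset.univ) (by simp)]
  rw [Finset.sum_congr rfl (fun i _ => hS i)]
  simp

open scoped Classical in
theorem MPT.exists_low {c r : ℕ} (T : MPT c r) {S : Finset (Fin c × Fin r)}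
    (hS : IsTransversal S) (hn : ¬ T.StrongOn S) :
    ∃ x ∈ S, min (T.outDegOn S x) (T.inDegOn S x) ≤ (c - 2) / 4 := by
  unfold MPT.StrongOn at hn
  push Not at hn
  obtain ⟨u, hu, v, hv, huv⟩ := hn
  set R := (fun a b => a ∈ S ∧ b ∈ S ∧ T.adj a b) with hRdef
  have hcard := Finset.card_filter_add_card_filter_not (s := S)
    (fun x => Relation.ReflTransGen R u x)
  rw [hS.card_eq] at hcard
  set A := S.filter (fun x => Relation.ReflTransGen R u x) with hA
  set B := S.filter (fun x => ¬ Relation.ReflTransGen R u x) with hB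
  have key : ∀ x ∈ A, ∀ y ∈ S, T.adj x y → y ∈ A := by
    intro x hx y hy hxy
    rw [hA, Finset.mem_filter] at hx ⊢
    exact ⟨hy, hx.2.tail ⟨hx.1, hy, hxy⟩⟩
  have key' : ∀ x ∈ B, ∀ y ∈ S, T.adj y x → y ∈ B := by
    intro x hx y hy hxy
    rw [hB, Finset.mem_filter] at hx ⊢
    exact ⟨hy, fun hr => hx.2 (hr.tail ⟨hy, hx.1, hxy⟩)⟩
  have hAne : A.Nonempty := ⟨u, by rw [hA, Finset.mem_filter]; exact ⟨hu, .refl⟩⟩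
  have hBne : B.Nonempty := ⟨v, by rw [hB, Finset.mem_filter]; exact ⟨hv, huv⟩⟩
  by_cases hle : 2 * A.card ≤ c
  · obtain ⟨x, hx, hd⟩ := exists_low_out T.adj T.adj_asymm A hAne
    refine ⟨x, (Finset.mem_filter.1 hx).1, (min_le_left _ _).trans ?_⟩
    have : T.outDegOn S x = (A.filter (fun y => T.adj x y)).card := by
      unfold MPT.outDegOn
      apply Nat.subtype_card
      intro y
      simp only [Finset.mem_filter]
      exact ⟨fun h => ⟨(Finset.mem_filter.1 h.1).1, h.2⟩, fun h => ⟨key x hx y h.1 h.2, h.2⟩⟩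
    omega
  · obtain ⟨x, hx, hd⟩ := exists_low_out (fun a b => T.adj b a)
      (fun a b => T.adj_asymm b a) B hBne
    refine ⟨x, (Finset.mem_filter.1 hx).1, (min_le_right _ _).trans ?_⟩
    have : T.inDegOn S x = (B.filter (fun y => T.adj y x)).card := by
      unfold MPT.inDegOn
      apply Nat.subtype_card
      intro y
      simp only [Finset.mem_filter]
      exact ⟨fun h => ⟨(Finset.mem_filter.1 h.1).1, h.2⟩, fun h => ⟨key' x hx y h.1 h.2, h.2⟩⟩
    omega

/-- The transversal with index `j` given by a family of permutations. -/
def tset {c r : ℕ} (τ : Fin c → Equiv.Perm (Fin r)) (j : Fin r) : Finset (Fin c × Fin r) :=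
  Finset.univ.filter (fun v => τ v.1 j = v.2)

/-- The partition given by a family of permutations. -/
def tpart {c r : ℕ} (τ : Fin c → Equiv.Perm (Fin r)) : Finset (Finset (Fin c × Fin r)) :=
  Finset.univ.image (tset τ)

theorem mem_tset {c r : ℕ} (τ : Fin c → Equiv.Perm (Fin r)) (j : Fin r) (v : Fin c × Fin r) :
    v ∈ tset τ j ↔ τ v.1 j = v.2 := by
  simp [tset]

theorem tpart_isMT {c r : ℕ} (τ : Fin c → Equiv.Perm (Fin r)) : IsMTPartition (tpart τ) := by
  refine ⟨?_, ?_, ?_⟩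
  · intro S hS i
    obtain ⟨j, -, rfl⟩ := Finset.mem_image.1 hS
    rw [Finset.card_eq_one]
    refine ⟨(i, τ i j), ?_⟩
    ext ⟨a, b⟩
    simp only [Finset.mem_filter, mem_tset, Finset.mem_singleton, Prod.mk.injEq]
    constructor
    · rintro ⟨h1, rfl⟩
      exact ⟨rfl, h1.symm⟩
    · rintro ⟨rfl, rfl⟩
      exact ⟨rfl, rfl⟩
  · intro S hS S' hS' hne
    obtain ⟨j, -, rfl⟩ := Finset.mem_image.1 hS
    obtain ⟨j', -, rfl⟩ := Finset.mem_image.1 hS'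
    rw [Finset.disjoint_left]
    intro v hv hv'
    rw [mem_tset] at hv hv'
    exact hne (by rw [(τ v.1).injective (hv.trans hv'.symm)])
  · intro v
    exact ⟨tset τ ((τ v.1).symm v.2), Finset.mem_image_of_mem _ (Finset.mem_univ _),
      by simp [mem_tset]⟩

theorem tpart_inj {n r : ℕ} :
    Function.Injective (fun σ : Fin n → Equiv.Perm (Fin r) =>
      tpart (Fin.cons (α := fun _ => Equiv.Perm (Fin r)) 1 σ)) := by
  intro σ σ' h
  funext i
  ext1 j
  have h1 : tset (Fin.cons (α := fun _ => Equiv.Perm (Fin r)) 1 σ) j ∈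
      tpart (Fin.cons (α := fun _ => Equiv.Perm (Fin r)) 1 σ') := by
    have h' : tpart (Fin.cons (α := fun _ => Equiv.Perm (Fin r)) 1 σ) =
      tpart (Fin.cons (α := fun _ => Equiv.Perm (Fin r)) 1 σ') := h
    rw [← h']
    exact Finset.mem_image_of_mem _ (Finset.mem_univ _)
  obtain ⟨j', -, hj⟩ := Finset.mem_image.1 h1
  have h2 := congrArg (fun S => ((0, j) : Fin (n+1) × Fin r) ∈ S) hj
  simp only [mem_tset, Fin.cons_zero, Equiv.Perm.coe_one, id_eq, eq_iff_iff, iff_true] at h2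
  subst h2
  have h3 := congrArg (fun S => ((i.succ, σ i j') : Fin (n+1) × Fin r) ∈ S) hj
  simp only [mem_tset, Fin.cons_succ, eq_iff_iff, iff_true] at h3
  exact h3.symm

/-- if `G_{r,c}` has no strong partition, then
`ω(G_{r,c}) ≥ (r!)^(c−1)`. -/
theorem omega_lower_bound_of_no_strong_partition
    (c r : ℕ) (hc : 2 ≤ c) (hr : 1 ≤ r) (T : MPT c r)
    (h : ¬ T.HasStrongPartition) :
    T.omegaG ≥ r.factorial ^ (c - 1) := by
  classical
  obtain ⟨n, rfl⟩ : ∃ n, c = n + 1 := ⟨c - 1, by omega⟩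
  have hpos : ∀ P ∈ Finset.univ.filter
      (fun P : Finset (Finset (Fin (n+1) × Fin r)) => IsMTPartition P), 1 ≤ T.omegaP P := by
    intro P hP
    have hP' := (Finset.mem_filter.1 hP).2
    have : ∃ S ∈ P, ¬ T.StrongOn S := by
      by_contra hcon
      push Not at hcon
      exact h ⟨P, hP', hcon⟩
    obtain ⟨S, hSP, hS⟩ := this
    obtain ⟨x, hx, hlow⟩ := T.exists_low (hP'.1 S hSP) hS
    unfold MPT.omegaP
    have : Nonempty {x : Fin (n+1) × Fin r // ∃ S ∈ P, x ∈ S ∧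
      min (T.outDegOn S x) (T.inDegOn S x) ≤ (n + 1 - 2) / 4} := ⟨⟨x, S, hSP, hx, hlow⟩⟩
    exact Nat.card_pos
  have h1 : (Finset.univ.filter
      (fun P : Finset (Finset (Fin (n+1) × Fin r)) => IsMTPartition P)).card ≤ T.omegaG := by
    unfold MPT.omegaG
    rw [Finset.card_eq_sum_ones]
    convert Finset.sum_le_sum hpos
  have h2 : (Finset.univ : Finset (Fin n → Equiv.Perm (Fin r))).card ≤ (Finset.univ.filter
      (fun P : Finset (Finset (Fin (n+1) × Fin r)) => IsMTPartition P)).card :=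
    Finset.card_le_card_of_injOn _
      (fun σ _ => by
        simp only [Finset.coe_filter, Finset.mem_univ, true_and, Set.mem_setOf_eq]
        exact tpart_isMT _) (tpart_inj.injOn)
  have h3 : (Finset.univ : Finset (Fin n → Equiv.Perm (Fin r))).card
      = r.factorial ^ (n + 1 - 1) := by
    simp [Fintype.card_perm]
  rw [← h3]
  exact h2.trans h1
end
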